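/- Let Δ ⊂ ℝ² be a 2-dimensional lattice polytope which is maximal and nonhyperelliptic, let g be the number of interior lattice points of Δ and g^{(1)} the number of interior lattice points of Δ^{(1)}. Then #(Δ ∩ ℤ²) − c(Δ) − 3 ≤ 2g + 3 − g^{(1)}. -/

import Mathlib

noncomputable section

/-- The embedding of the integer lattice `ℤ²` into the plane `ℝ²`. -/
def toR2 (p : ℤ × ℤ) : ℝ × ℝ := ((p.1 : ℝ), (p.2 : ℝ))

/-- A lattice polytope in `ℝ²`: the convex hull of a finite set of lattice points. -/
def IsLatticePolytope (Δ : Set (ℝ × ℝ)) : Prop :=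
  ∃ S : Finset (ℤ × ℤ), Δ = convexHull ℝ (toR2 '' (S : Set (ℤ × ℤ)))

/-- The lattice points of `Δ`. -/
def latticePts (Δ : Set (ℝ × ℝ)) : Set (ℤ × ℤ) := {p | toR2 p ∈ Δ}

/-- The interior lattice points of `Δ`. -/
def intPts (Δ : Set (ℝ × ℝ)) : Set (ℤ × ℤ) := {p | toR2 p ∈ interior Δ}

/-- The boundary lattice points of `Δ`. -/
def bdPts (Δ : Set (ℝ × ℝ)) : Set (ℤ × ℤ) := {p | toR2 p ∈ frontier Δ}

/-- `Δ⁽¹⁾`: the convex hull of the interior lattice points of `Δ`. -/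
def interiorHull (Δ : Set (ℝ × ℝ)) : Set (ℝ × ℝ) := convexHull ℝ (toR2 '' intPts Δ)

/-- `Δ` is maximal: any lattice polytope strictly containing `Δ` has a different set of
interior lattice points. -/
def IsMaximalPolytope (Δ : Set (ℝ × ℝ)) : Prop :=
  ∀ Δ' : Set (ℝ × ℝ), IsLatticePolytope Δ' → Δ ⊂ Δ' → intPts Δ' ≠ intPts Δ

/-- `Δ` is hyperelliptic: its interior lattice points are collinear. -/
def IsHyperelliptic (Δ : Set (ℝ × ℝ)) : Prop := Collinear ℝ (toR2 '' intPts Δ)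

/-- A facet (edge) of `Δ`: a one-dimensional exposed face. -/
def IsFacet (Δ τ : Set (ℝ × ℝ)) : Prop :=
  IsExposed ℝ Δ τ ∧ Collinear ℝ τ ∧ ¬ τ.Subsingleton

/-- `v` is a column vector of `Δ`: `v ≠ 0` and there is a facet `τ` (the base facet)
such that `v + ((Δ ∖ τ) ∩ ℤ²) ⊆ Δ`. -/
def IsColumnVector (Δ : Set (ℝ × ℝ)) (v : ℤ × ℤ) : Prop :=
  v ≠ 0 ∧ ∃ τ : Set (ℝ × ℝ), IsFacet Δ τ ∧
    ∀ p : ℤ × ℤ, toR2 p ∈ Δ \ τ → toR2 (p + v) ∈ Δ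

/-- `c(Δ)`: the number of column vectors of `Δ`. -/
def colCount (Δ : Set (ℝ × ℝ)) : ℕ := {v : ℤ × ℤ | IsColumnVector Δ v}.ncard

/-- The integer linear functional with coefficient vector `u`, evaluated at `p`. -/
def dot (u p : ℤ × ℤ) : ℤ := u.1 * p.1 + u.2 * p.2

/-- The points on which no nonzero integer functional attains its maximum over `S`. -/
def latInterior (S : Set (ℤ × ℤ)) : Set (ℤ × ℤ) :=
  {p | ∀ u : ℤ × ℤ, u ≠ 0 → ∃ s ∈ S, dot u p < dot u s}

/-- `S` contains every lattice point that no integer functional separates from it. -/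
def LatticeConvex (S : Set (ℤ × ℤ)) : Prop :=
  ∀ p : ℤ × ℤ, (∀ u : ℤ × ℤ, ∃ s ∈ S, dot u p ≤ dot u s) → p ∈ S

/-- The lattice version of a column vector. -/
def IsLatticeColumn (S : Set (ℤ × ℤ)) (v : ℤ × ℤ) : Prop :=
  v ≠ 0 ∧ ∃ u : ℤ × ℤ, ∃ c : ℤ, u ≠ 0 ∧ (∀ s ∈ S, dot u s ≤ c) ∧
    (∃ s ∈ S, ∃ t ∈ S, s ≠ t ∧ dot u s = c ∧ dot u t = c) ∧
    ∀ p ∈ S, dot u p < c → p + v ∈ S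

/-- The inequality to be proved, in terms of lattice points only. -/
def ColumnBound (S : Set (ℤ × ℤ)) : Prop :=
  ∃ C : Finset (ℤ × ℤ), (∀ v ∈ C, IsLatticeColumn S v) ∧
    S.ncard + (latInterior (latInterior S)).ncard ≤ 2 * (latInterior S).ncard + 6 + C.card

/-- `p` lies on the upper boundary of `S`. -/
def IsUpper (S : Set (ℤ × ℤ)) (p : ℤ × ℤ) : Prop :=
  ∃ u : ℤ × ℤ, 0 < u.2 ∧ ∀ s ∈ S, dot u s ≤ dot u p

/-- `p` lies on the lower boundary of `S`. -/
def IsLower (S : Set (ℤ × ℤ)) (p : ℤ × ℤ) : Prop :=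
  ∃ u : ℤ × ℤ, u.2 < 0 ∧ ∀ s ∈ S, dot u s ≤ dot u p

theorem latInterior_subset {S : Set (ℤ × ℤ)} (hS : LatticeConvex S) : latInterior S ⊆ S := by
  intro p hp
  refine hS p fun u => ?_
  by_cases hu : u = 0
  · obtain ⟨s, hs, -⟩ := hp (1, 0) (by simp)
    exact ⟨s, hs, by simp [hu, dot]⟩
  · obtain ⟨s, hs, h⟩ := hp u hu
    exact ⟨s, hs, h.le⟩

theorem latInterior_latInterior_subset (S : Set (ℤ × ℤ)) :
    latInterior (latInterior S) ⊆ latInterior S := by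
  intro p hp u hu
  obtain ⟨i, hi, h⟩ := hp u hu
  obtain ⟨s, hs, h'⟩ := hi u hu
  exact ⟨s, hs, h.trans h'⟩

/-- A lattice point that is a convex combination, with a positive weight on an interior point,
is interior. -/
theorem mem_latInterior_of_combination {S : Set (ℤ × ℤ)} {i s t q : ℤ × ℤ} {a b c : ℤ}
    (hi : i ∈ latInterior S) (hs : s ∈ S) (ht : t ∈ S) (ha : 0 < a) (hb : 0 ≤ b) (hc : 0 ≤ c)
    (h1 : (a + b + c) * q.1 = a * i.1 + b * s.1 + c * t.1)
    (h2 : (a + b + c) * q.2 = a * i.2 + b * s.2 + c * t.2) : q ∈ latInterior S := by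
  intro u hu
  obtain ⟨r, hr, hir⟩ := hi u hu
  by_contra! hcon
  have h : (a + b + c) * dot u q = a * dot u i + b * dot u s + c * dot u t := by
    simp only [dot]; linear_combination u.1 * h1 + u.2 * h2
  have e1 := hcon r hr
  have e2 := hcon s hs
  have e3 := hcon t ht
  nlinarith [mul_lt_mul_of_pos_left (hir.trans_le e1) ha, mul_le_mul_of_nonneg_left e2 hb,
    mul_le_mul_of_nonneg_left e3 hc]

theorem IsUpper.eq_of_fst_eq {S : Set (ℤ × ℤ)} {p q : ℤ × ℤ} (hp : IsUpper S p) (hq : IsUpper S q)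
    (hpS : p ∈ S) (hqS : q ∈ S) (h : p.1 = q.1) : p = q := by
  obtain ⟨u, hu, hu'⟩ := hp
  obtain ⟨w, hw, hw'⟩ := hq
  have e1 := hu' q hqS
  have e2 := hw' p hpS
  simp only [dot, h] at e1 e2
  refine Prod.ext h (le_antisymm ?_ ?_)
  · exact le_of_mul_le_mul_left (by linarith) hw
  · exact le_of_mul_le_mul_left (by linarith) hu

/-! ### Affine unimodular coordinates -/

/-- The affine map with linear part given by the functionals `A`, `B`. -/
def coordMap (A B c p : ℤ × ℤ) : ℤ × ℤ := (dot A p - c.1, dot B p - c.2)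

section coordMap

variable {A B c : ℤ × ℤ} {S : Set (ℤ × ℤ)}

theorem dot_coordMap (u p : ℤ × ℤ) : dot u (coordMap A B c p) =
    dot (u.1 * A.1 + u.2 * B.1, u.1 * A.2 + u.2 * B.2) p - dot u c := by
  simp only [dot, coordMap]; ring

theorem coordMap_injective (h : A.1 * B.2 - A.2 * B.1 = 1) :
    Function.Injective (coordMap A B c) := by
  intro p q hpq
  simp only [coordMap, dot, Prod.mk.injEq] at hpq
  obtain ⟨h1, h2⟩ := hpq
  ext
  · linear_combination B.2 * h1 - A.2 * h2 - (p.1 - q.1) * h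
  · linear_combination A.1 * h2 - B.1 * h1 - (p.2 - q.2) * h

theorem coordMap_surjective (h : A.1 * B.2 - A.2 * B.1 = 1) :
    Function.Surjective (coordMap A B c) := by
  intro p
  refine ⟨(B.2 * (p.1 + c.1) - A.2 * (p.2 + c.2), A.1 * (p.2 + c.2) - B.1 * (p.1 + c.1)), ?_⟩
  simp only [coordMap, dot]
  ext
  · simp only; linear_combination (p.1 + c.1) * h
  · simp only; linear_combination (p.2 + c.2) * h

/-- Pulling a functional back along `coordMap` preserves nonvanishing. -/
theorem pullback_ne_zero (h : A.1 * B.2 - A.2 * B.1 = 1) {u : ℤ × ℤ} (hu : u ≠ 0) :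
    (u.1 * A.1 + u.2 * B.1, u.1 * A.2 + u.2 * B.2) ≠ (0 : ℤ × ℤ) := by
  contrapose! hu
  obtain ⟨h1, h2⟩ := Prod.ext_iff.1 hu
  simp only [Prod.fst_zero, Prod.snd_zero] at h1 h2
  refine Prod.ext ?_ ?_
  · simp only [Prod.fst_zero]; linear_combination B.2 * h1 - B.1 * h2 - u.1 * h
  · simp only [Prod.snd_zero]; linear_combination A.1 * h2 - A.2 * h1 - u.2 * h

theorem exists_pullback_eq (h : A.1 * B.2 - A.2 * B.1 = 1) (w : ℤ × ℤ) :
    ∃ u : ℤ × ℤ, (u.1 * A.1 + u.2 * B.1, u.1 * A.2 + u.2 * B.2) = w := by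
  refine ⟨(w.1 * B.2 - w.2 * B.1, w.2 * A.1 - w.1 * A.2), Prod.ext ?_ ?_⟩
  · simp only; linear_combination w.1 * h
  · simp only; linear_combination w.2 * h

theorem latInterior_image (h : A.1 * B.2 - A.2 * B.1 = 1) :
    latInterior (coordMap A B c '' S) = coordMap A B c '' latInterior S := by
  ext q
  obtain ⟨p, rfl⟩ := coordMap_surjective (c := c) h q
  rw [(coordMap_injective h).mem_set_image]
  simp only [latInterior, Set.mem_ofPred_eq, Set.exists_mem_image, dot_coordMap,
    sub_lt_sub_iff_right]
  constructor
  · intro H w hw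
    obtain ⟨u, rfl⟩ := exists_pullback_eq h w
    exact H u (by rintro rfl; simp at hw)
  · intro H u hu
    exact H _ (pullback_ne_zero h hu)

theorem LatticeConvex.image (hS : LatticeConvex S) (h : A.1 * B.2 - A.2 * B.1 = 1) :
    LatticeConvex (coordMap A B c '' S) := by
  intro q
  obtain ⟨p, rfl⟩ := coordMap_surjective (c := c) h q
  rw [(coordMap_injective h).mem_set_image]
  simp only [Set.exists_mem_image, dot_coordMap, sub_le_sub_iff_right]
  intro H
  refine hS p fun w => ?_
  obtain ⟨u, rfl⟩ := exists_pullback_eq h w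
  exact H u

theorem IsLatticeColumn.of_image (h : A.1 * B.2 - A.2 * B.1 = 1) {v : ℤ × ℤ}
    (hv : IsLatticeColumn (coordMap A B c '' S) (coordMap A B 0 v)) : IsLatticeColumn S v := by
  obtain ⟨hv0, u, d, hu, hle, hface, hcol⟩ := hv
  have hadd : ∀ p, coordMap A B c p + coordMap A B 0 v = coordMap A B c (p + v) := by
    intro p; simp only [coordMap, dot, Prod.mk_add_mk, Prod.fst_add, Prod.snd_add]
    ext <;> simp <;> ring
  simp only [Set.forall_mem_image, Set.exists_mem_image, dot_coordMap, hadd,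
    (coordMap_injective h).mem_set_image, (coordMap_injective h).ne_iff] at hle hface hcol
  refine ⟨?_, _, d + dot u c, pullback_ne_zero h hu, fun s hs => ?_, ?_, fun p hp hlt => ?_⟩
  · rintro rfl
    exact hv0 (by simp [coordMap, dot])
  · linarith [hle hs]
  · obtain ⟨s, hs, t, ht, hst, e1, e2⟩ := hface
    exact ⟨s, hs, t, ht, hst, by linarith, by linarith⟩
  · exact hcol hp (by linarith)

theorem ColumnBound.of_image (h : A.1 * B.2 - A.2 * B.1 = 1)
    (hB : ColumnBound (coordMap A B c '' S)) : ColumnBound S := by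
  classical
  obtain ⟨C, hC, hle⟩ := hB
  rw [latInterior_image h, latInterior_image h] at hle
  simp only [Set.ncard_image_of_injective _ (coordMap_injective h)] at hle
  have hinj := coordMap_injective (c := 0) h
  refine ⟨C.preimage (coordMap A B 0) hinj.injOn, fun v hv => ?_, ?_⟩
  · exact IsLatticeColumn.of_image h (hC _ (Finset.mem_preimage.1 hv))
  · rw [Finset.card_preimage, Finset.filter_true_of_mem]
    · exact hle
    · intro x _
      exact coordMap_surjective h x

end coordMap

/-! ### Polygons whose interior points fill the width up to one at both ends -/

/-- A finite lattice convex set with `0 ≤ x ≤ N` such that both extreme columns are occupied and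
the columns next to them contain interior points. -/
structure IsStrip (S : Set (ℤ × ℤ)) (N : ℤ) : Prop where
  finite : S.Finite
  convex : LatticeConvex S
  nonneg : ∀ s ∈ S, 0 ≤ s.1
  le : ∀ s ∈ S, s.1 ≤ N
  exists_left : ∃ s ∈ S, s.1 = 0
  exists_right : ∃ s ∈ S, s.1 = N
  exists_interior_left : ∃ i ∈ latInterior S, i.1 = 1
  exists_interior_right : ∃ i ∈ latInterior S, i.1 = N - 1
  three_le : 3 ≤ N

namespace IsStrip

variable {S : Set (ℤ × ℤ)} {N : ℤ}

theorem one_le (h : IsStrip S N) {i : ℤ × ℤ} (hi : i ∈ latInterior S) : 1 ≤ i.1 := by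
  obtain ⟨s, hs, hlt⟩ := hi (-1, 0) (by simp)
  have := h.nonneg s hs
  simp only [dot] at hlt
  linarith

theorem le_sub_one (h : IsStrip S N) {i : ℤ × ℤ} (hi : i ∈ latInterior S) : i.1 ≤ N - 1 := by
  obtain ⟨s, hs, hlt⟩ := hi (1, 0) (by simp)
  have := h.le s hs
  simp only [dot] at hlt
  linarith

theorem interior_finite (h : IsStrip S N) : (latInterior S).Finite :=
  h.finite.subset (latInterior_subset h.convex)

theorem rotate (h : IsStrip S N) : IsStrip (coordMap (-1, 0) (0, -1) (-N, 0) '' S) N := by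
  have hdet : ((-1, 0) : ℤ × ℤ).1 * ((0, -1) : ℤ × ℤ).2 -
      ((-1, 0) : ℤ × ℤ).2 * ((0, -1) : ℤ × ℤ).1 = 1 := by norm_num
  refine ⟨h.finite.image _, h.convex.image hdet, ?_, ?_, ?_, ?_, ?_, ?_, h.three_le⟩ <;>
    simp only [latInterior_image hdet, Set.forall_mem_image, Set.exists_mem_image, coordMap, dot]
  · intro s hs; linarith [h.le s hs]
  · intro s hs; linarith [h.nonneg s hs]
  · obtain ⟨s, hs, e⟩ := h.exists_right; exact ⟨s, hs, by linarith⟩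
  · obtain ⟨s, hs, e⟩ := h.exists_left; exact ⟨s, hs, by linarith⟩
  · obtain ⟨s, hs, e⟩ := h.exists_interior_right; exact ⟨s, hs, by linarith⟩
  · obtain ⟨s, hs, e⟩ := h.exists_interior_left; exact ⟨s, hs, by linarith⟩

/-- A point on the upper boundary that is not in the last column starts an edge of the upper
boundary, ending at `(k + a, y + b)`, all of whose relative interior lattice columns contain no
other upper boundary point. -/
theorem exists_upper_edge (h : IsStrip S N) {p : ℤ × ℤ} (hpS : p ∈ S) (hpN : p.1 < N)
    (hup : IsUpper S p) :
    ∃ p' ∈ S, p.1 < p'.1 ∧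
      (∀ s ∈ S, (s.2 - p.2) * (p'.1 - p.1) ≤ (p'.2 - p.2) * (s.1 - p.1)) ∧
      ∀ r ∈ S, IsUpper S r → p.1 < r.1 → p'.1 ≤ r.1 := by
  obtain ⟨e, he, heN⟩ := h.exists_right
  set slope : ℤ × ℤ → ℚ := fun s => (s.2 - p.2) / (s.1 - p.1) with hslope
  have hR : (S ∩ {s | p.1 < s.1}).Finite := h.finite.inter_of_left _
  obtain ⟨m, hm, hmax⟩ := Set.exists_max_image _ slope hR ⟨e, he, by simpa [heN] using hpN⟩
  have hR' : (S ∩ {s | p.1 < s.1 ∧ slope s = slope m}).Finite := h.finite.inter_of_left _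
  obtain ⟨p', ⟨hp', hlt, hsl⟩, hmin⟩ :=
    Set.exists_min_image _ Prod.fst hR' ⟨m, hm.1, hm.2, rfl⟩
  have hright : ∀ s ∈ S, p.1 < s.1 →
      (s.2 - p.2) * (p'.1 - p.1) ≤ (p'.2 - p.2) * (s.1 - p.1) := by
    intro s hs hps
    have hle := hmax s ⟨hs, hps⟩
    rw [← hsl, hslope] at hle
    have h1 : (0 : ℚ) < s.1 - p.1 := by exact_mod_cast sub_pos.2 hps
    have h2 : (0 : ℚ) < p'.1 - p.1 := by exact_mod_cast sub_pos.2 hlt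
    simp only at hle
    rw [div_le_div_iff₀ h1 h2] at hle
    exact_mod_cast hle
  refine ⟨p', hp', hlt, fun s hs => ?_, fun r hr hru hpr => ?_⟩
  · rcases lt_or_ge p.1 s.1 with hps | hps
    · exact hright s hs hps
    · obtain ⟨u, hu, hu'⟩ := hup
      have e1 := hu' s hs
      have e2 := hu' p' hp'
      simp only [dot] at e1 e2
      have e3 : u.1 * (p'.1 - p.1) + u.2 * (p'.2 - p.2) ≤ 0 := by linarith
      have e4 : u.1 * (s.1 - p.1) + u.2 * (s.2 - p.2) ≤ 0 := by linarith
      refine le_of_mul_le_mul_left ?_ hu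
      nlinarith [mul_le_mul_of_nonneg_right e3 (sub_nonneg.2 hps),
        mul_le_mul_of_nonneg_right e4 (sub_pos.2 hlt).le]
  · by_contra! hcon
    obtain ⟨u, hu, hu'⟩ := hru
    have e1 := hu' p' hp'
    have e2 := hu' p hpS
    simp only [dot] at e1 e2
    have e3 : (p'.2 - p.2) * (r.1 - p.1) ≤ (r.2 - p.2) * (p'.1 - p.1) := by
      refine le_of_mul_le_mul_left ?_ hu
      nlinarith [mul_le_mul_of_nonneg_right e1 (sub_pos.2 hpr).le,
        mul_le_mul_of_nonneg_right e2 (sub_pos.2 hcon).le]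
    have e4 : (r.2 - p.2) * (p'.1 - p.1) = (p'.2 - p.2) * (r.1 - p.1) :=
      le_antisymm (hright r hr hpr) e3
    refine absurd (hmin r ⟨hr, hpr, ?_⟩) (not_le.2 hcon)
    have h1 : (r.1 - p.1 : ℚ) ≠ 0 := by exact_mod_cast (sub_pos.2 hpr).ne'
    have h2 : (p'.1 - p.1 : ℚ) ≠ 0 := by exact_mod_cast (sub_pos.2 hlt).ne'
    rw [← hsl, hslope]
    simp only
    rw [div_eq_div_iff h1 h2]
    exact_mod_cast e4

/-- The point one lattice step below an edge of the upper boundary, taken above or just after the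
start `p` of the edge, is an interior point on the upper boundary of the interior. -/
theorem exists_upper_interior (h : IsStrip S N) {p : ℤ × ℤ} (hpS : p ∈ S) (hp1 : 1 ≤ p.1)
    (hpN : p.1 < N) (hup : IsUpper S p) :
    ∃ q ∈ latInterior S, IsUpper (latInterior S) q ∧ p.1 ≤ q.1 ∧
      ∀ r ∈ S, IsUpper S r → p.1 < r.1 → q.1 < r.1 := by
  obtain ⟨p', hp', hlt, hedge, hnext⟩ := h.exists_upper_edge hpS hpN hup
  obtain ⟨s₁, hs₁⟩ : ∃ s₁, s₁ = p'.1 - p.1 := ⟨_, rfl⟩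
  obtain ⟨s₂, hs₂⟩ : ∃ s₂, s₂ = p'.2 - p.2 := ⟨_, rfl⟩
  have hpos : 0 < s₁ := by linarith
  have hbez := Int.gcd_eq_gcd_ab s₁ s₂
  have hgpos : (0 : ℤ) < (Int.gcd s₁ s₂ : ℤ) := by
    exact_mod_cast Int.gcd_pos_of_ne_zero_left _ hpos.ne'
  have hd₁ : (Int.gcd s₁ s₂ : ℤ) ∣ s₁ := Int.gcd_dvd_left ..
  have hd₂ : (Int.gcd s₁ s₂ : ℤ) ∣ s₂ := Int.gcd_dvd_right ..
  generalize (Int.gcd s₁ s₂ : ℤ) = g at hbez hgpos hd₁ hd₂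
  obtain ⟨dx, hdx⟩ : ∃ dx, dx = Int.gcdB s₁ s₂ % s₁ := ⟨_, rfl⟩
  obtain ⟨dy, hdy⟩ : ∃ dy, dy = -s₂ * (Int.gcdB s₁ s₂ / s₁) - Int.gcdA s₁ s₂ := ⟨_, rfl⟩
  have hstep : s₁ * dy = s₂ * dx - g := by
    have := Int.emod_add_mul_ediv (Int.gcdB s₁ s₂) s₁
    rw [← hdx] at this
    rw [hdy]
    linear_combination hbez - s₂ * this
  have hdx0 : 0 ≤ dx := hdx ▸ Int.emod_nonneg _ hpos.ne'
  have hdx1 : dx < s₁ := hdx ▸ Int.emod_lt_of_pos _ hpos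
  have hbelow : ∀ i ∈ latInterior S, s₁ * (i.2 - p.2) - s₂ * (i.1 - p.1) ≤ -g := by
    intro i hi
    obtain ⟨s, hs, hlt'⟩ := hi (-s₂, s₁) (by simp [hpos.ne'])
    have := hedge s hs
    simp only [dot, ← hs₁, ← hs₂] at hlt' this
    have hneg : 0 < s₂ * (i.1 - p.1) - s₁ * (i.2 - p.2) := by nlinarith
    have := Int.le_of_dvd hneg (dvd_sub (hd₂.mul_right _) (hd₁.mul_right _))
    linarith
  have hp'N := h.le p' hp'
  refine ⟨(p.1 + dx, p.2 + dy), fun w hw => ?_, ⟨(-s₂, s₁), hpos, fun i hi => ?_⟩, by simpa,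
    fun r hr hru hpr => ?_⟩
  · by_contra! hcon
    rcases lt_or_ge 0 w.2 with hw2 | hw2
    · have e1 := hcon p hpS
      have e2 := hcon p' hp'
      simp only [dot] at e1 e2
      have e3 : 0 ≤ w.1 * dx + w.2 * dy := by linarith
      have e4 : w.1 * s₁ + w.2 * s₂ ≤ w.1 * dx + w.2 * dy := by rw [hs₁, hs₂]; linarith
      nlinarith [mul_nonneg e3 (sub_pos.2 hdx1).le, mul_le_mul_of_nonneg_right e4 hdx0,
        mul_pos hw2 hgpos]
    · obtain ⟨a, ha, ha1⟩ := h.exists_interior_left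
      obtain ⟨b, hb, hb1⟩ := h.exists_interior_right
      obtain ⟨sa, hsa, hlta⟩ := ha w hw
      obtain ⟨sb, hsb, hltb⟩ := hb w hw
      have ea := hlta.trans_le (hcon sa hsa)
      have eb := hltb.trans_le (hcon sb hsb)
      have ba := hbelow a ha
      have bb := hbelow b hb
      simp only [dot, ha1, hb1] at ea eb ba bb
      have hX1 : 0 ≤ p.1 + dx - 1 := by linarith
      have hX2 : 0 ≤ N - 1 - (p.1 + dx) := by linarith
      have hN := h.three_le
      have ca : s₁ * (a.2 - (p.2 + dy)) ≤ s₂ * (1 - (p.1 + dx)) := by linarith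
      have cb : s₁ * (b.2 - (p.2 + dy)) ≤ s₂ * (N - 1 - (p.1 + dx)) := by linarith
      generalize p.1 + dx = X at *
      generalize p.2 + dy = Y at *
      have hsum : (N - 1 - X) * (a.2 - Y) + (X - 1) * (b.2 - Y) ≤ 0 := by
        by_contra! hc
        nlinarith [mul_le_mul_of_nonneg_left ca hX2, mul_le_mul_of_nonneg_left cb hX1,
          mul_pos hpos hc]
      have e5 : 0 ≤ w.2 * ((N - 1 - X) * (a.2 - Y) + (X - 1) * (b.2 - Y)) :=
        mul_nonneg_of_nonpos_of_nonpos hw2 hsum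
      have e6 : w.1 * (1 - X) + w.2 * (a.2 - Y) ≤ -1 := by linarith
      have e7 : w.1 * (N - 1 - X) + w.2 * (b.2 - Y) ≤ -1 := by linarith
      nlinarith [mul_le_mul_of_nonneg_left e6 hX2, mul_le_mul_of_nonneg_left e7 hX1]
  · have := hbelow i hi
    simp only [dot]
    linarith
  · have := hnext r hr hru hpr
    simp only
    linarith

/-- The points of `S` on the upper boundary, in the columns strictly between the extreme ones,
are at most two more than the corresponding points of the interior. -/
theorem ncard_upper_le (h : IsStrip S N) :
    {s ∈ S | 0 < s.1 ∧ s.1 < N ∧ IsUpper S s}.ncard ≤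
      {i ∈ latInterior S | 1 < i.1 ∧ i.1 < N - 1 ∧ IsUpper (latInterior S) i}.ncard + 2 := by
  have hfin := h.interior_finite
  have hex : ∀ p ∈ {s ∈ S | 0 < s.1 ∧ s.1 < N ∧ IsUpper S s}, ∃ q ∈ latInterior S,
      IsUpper (latInterior S) q ∧ p.1 ≤ q.1 ∧ ∀ r ∈ S, IsUpper S r → p.1 < r.1 → q.1 < r.1 :=
    fun p hp => h.exists_upper_interior hp.1 hp.2.1 hp.2.2.1 hp.2.2.2
  choose! f hfI hfU hfle hflt using hex
  have hle : {s ∈ S | 0 < s.1 ∧ s.1 < N ∧ IsUpper S s}.ncard ≤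
      {i ∈ latInterior S | IsUpper (latInterior S) i}.ncard := by
    refine Set.ncard_le_ncard_of_injOn f (fun p hp => ⟨hfI p hp, hfU p hp⟩) ?_ (hfin.sep _)
    intro p hp r hr hpr
    refine hp.2.2.2.eq_of_fst_eq hr.2.2.2 hp.1 hr.1 (le_antisymm ?_ ?_)
    · by_contra! hlt
      have := hflt r hr p hp.1 hp.2.2.2 hlt
      rw [← hpr] at this
      exact absurd (hfle p hp) (not_le.2 this)
    · by_contra! hlt
      have := hflt p hp r hr.1 hr.2.2.2 hlt
      rw [hpr] at this
      exact absurd (hfle r hr) (not_le.2 this)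
  have hone : ∀ k, {i ∈ latInterior S | i.1 = k ∧ IsUpper (latInterior S) i}.ncard ≤ 1 :=
    fun k => (Set.ncard_le_one (hfin.sep _)).2 fun a ha b hb =>
      ha.2.2.eq_of_fst_eq hb.2.2 ha.1 hb.1 (ha.2.1.trans hb.2.1.symm)
  have hsub : {i ∈ latInterior S | IsUpper (latInterior S) i} ⊆
      {i ∈ latInterior S | 1 < i.1 ∧ i.1 < N - 1 ∧ IsUpper (latInterior S) i} ∪
        {i ∈ latInterior S | i.1 = 1 ∧ IsUpper (latInterior S) i} ∪
        {i ∈ latInterior S | i.1 = N - 1 ∧ IsUpper (latInterior S) i} := by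
    rintro i ⟨hi, hiu⟩
    rcases (h.one_le hi).eq_or_lt with h1 | h1
    · exact Or.inl (Or.inr ⟨hi, h1.symm, hiu⟩)
    · rcases (h.le_sub_one hi).eq_or_lt with h2 | h2
      · exact Or.inr ⟨hi, h2, hiu⟩
      · exact Or.inl (Or.inl ⟨hi, h1, h2, hiu⟩)
  have h3 := Set.ncard_le_ncard hsub
    (((hfin.sep _).union (hfin.sep _)).union (hfin.sep _))
  have h4 := Set.ncard_union_le
    ({i ∈ latInterior S | 1 < i.1 ∧ i.1 < N - 1 ∧ IsUpper (latInterior S) i} ∪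
        {i ∈ latInterior S | i.1 = 1 ∧ IsUpper (latInterior S) i})
    {i ∈ latInterior S | i.1 = N - 1 ∧ IsUpper (latInterior S) i}
  have h5 := Set.ncard_union_le
    {i ∈ latInterior S | 1 < i.1 ∧ i.1 < N - 1 ∧ IsUpper (latInterior S) i}
    {i ∈ latInterior S | i.1 = 1 ∧ IsUpper (latInterior S) i}
  linarith [hone 1, hone (N - 1)]

theorem rotate_det : ((-1, 0) : ℤ × ℤ).1 * ((0, -1) : ℤ × ℤ).2 -
    ((-1, 0) : ℤ × ℤ).2 * ((0, -1) : ℤ × ℤ).1 = 1 := by norm_num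

theorem isUpper_rotate {p : ℤ × ℤ} : IsUpper (coordMap (-1, 0) (0, -1) (-N, 0) '' S)
    (coordMap (-1, 0) (0, -1) (-N, 0) p) ↔ IsLower S p := by
  simp only [IsUpper, IsLower, Set.forall_mem_image, dot_coordMap, sub_le_sub_iff_right]
  constructor
  · rintro ⟨u, hu, h⟩
    exact ⟨(-u.1, -u.2), by simpa using hu, fun s hs => by simpa [dot] using h hs⟩
  · rintro ⟨u, hu, h⟩
    exact ⟨(-u.1, -u.2), by simpa using hu, fun s hs => by simpa [dot] using h s hs⟩

theorem ncard_lower_le (h : IsStrip S N) :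
    {s ∈ S | 0 < s.1 ∧ s.1 < N ∧ IsLower S s}.ncard ≤
      {i ∈ latInterior S | 1 < i.1 ∧ i.1 < N - 1 ∧ IsLower (latInterior S) i}.ncard + 2 := by
  have key := h.rotate.ncard_upper_le
  have himage : ∀ (T : Set (ℤ × ℤ)) (k : ℤ),
      {s ∈ coordMap (-1, 0) (0, -1) (-N, 0) '' T | k < s.1 ∧ s.1 < N - k ∧
        IsUpper (coordMap (-1, 0) (0, -1) (-N, 0) '' T) s} =
      coordMap (-1, 0) (0, -1) (-N, 0) '' {s ∈ T | k < s.1 ∧ s.1 < N - k ∧ IsLower T s} := by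
    intro T k
    ext q
    obtain ⟨p, rfl⟩ := coordMap_surjective (c := (-N, 0)) rotate_det q
    simp only [Set.mem_ofPred_eq, (coordMap_injective rotate_det).mem_set_image, isUpper_rotate]
    simp only [coordMap, dot]
    constructor
    · rintro ⟨h1, h2, h3, h4⟩; exact ⟨h1, by linarith, by linarith, h4⟩
    · rintro ⟨h1, h2, h3, h4⟩; exact ⟨h1, by linarith, by linarith, h4⟩
  have h0 := himage S 0
  rw [sub_zero] at h0
  rw [latInterior_image rotate_det, h0, himage,
    Set.ncard_image_of_injective _ (coordMap_injective rotate_det),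
    Set.ncard_image_of_injective _ (coordMap_injective rotate_det)] at key
  exact key

/-- The line through `(0, F)` and the first non-interior point of the column `x = 1`, on either
side, bounds `S`. -/
theorem line_bound {F k e : ℤ} {p : ℤ × ℤ} (hF : (0, F) ∈ S) (hk : (1, k) ∈ latInterior S)
    (hke : (1, k + e) ∉ latInterior S) (hp : p ∈ S) (hp1 : 1 ≤ p.1) :
    e * (p.2 + p.1 * (F - e - k)) ≤ e * F := by
  simp only [latInterior, Set.mem_ofPred_eq, not_forall, not_exists, not_and, not_lt,
    exists_prop] at hke
  obtain ⟨w, hw, hle⟩ := hke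
  obtain ⟨s, hs, hlt⟩ := hk w hw
  have e1 := hlt.trans_le (hle s hs)
  have e2 := hle _ hF
  have e3 := hle p hp
  simp only [dot] at e1 e2 e3
  have e4 : 0 < w.2 * e := by linarith
  have e5 : w.2 * (p.2 + p.1 * (F - e - k) - F) ≤ 0 := by
    nlinarith [mul_le_mul_of_nonneg_right e2 (sub_nonneg.2 hp1)]
  by_contra! hcon
  have e6 : 0 < e * (p.2 + p.1 * (F - e - k) - F) := by linarith
  nlinarith [mul_pos e4 e6, mul_nonneg (sq_nonneg e) (neg_nonneg.2 e5)]

theorem exists_left_columns (h : IsStrip S N) :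
    ∃ C : Finset (ℤ × ℤ), (∀ v ∈ C, IsLatticeColumn S v ∧ v.1 = -1) ∧
      {s ∈ S | s.1 = 0}.ncard ≤ {i ∈ latInterior S | i.1 = 1}.ncard + 1 + C.card := by
  classical
  obtain ⟨s₀, hs₀⟩ := h.exists_left
  obtain ⟨i₀, hi₀⟩ := h.exists_interior_left
  have hSf : {s ∈ S | s.1 = 0}.Finite := h.finite.sep _
  have hIf : {i ∈ latInterior S | i.1 = 1}.Finite := h.interior_finite.sep _
  obtain ⟨⟨x₁, F⟩, ⟨hF, rfl⟩, hFmax⟩ := Set.exists_max_image _ Prod.snd hSf ⟨s₀, hs₀⟩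
  obtain ⟨⟨x₂, G⟩, ⟨hG, rfl⟩, hGmin⟩ := Set.exists_min_image _ Prod.snd hSf ⟨s₀, hs₀⟩
  obtain ⟨⟨x₃, k⟩, ⟨hk, rfl⟩, hkmax⟩ := Set.exists_max_image _ Prod.snd hIf ⟨i₀, hi₀⟩
  obtain ⟨⟨x₄, l⟩, ⟨hl, rfl⟩, hlmin⟩ := Set.exists_min_image _ Prod.snd hIf ⟨i₀, hi₀⟩
  simp only at hFmax hGmin hkmax hlmin
  have hGF : G ≤ F := hFmax _ ⟨hG, rfl⟩
  have hlk : l ≤ k := hkmax _ ⟨hl, rfl⟩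
  have hk' : (1, k + 1) ∉ latInterior S := fun hc => by
    have := hkmax _ ⟨hc, rfl⟩; simp at this
  have hl' : (1, l + -1) ∉ latInterior S := fun hc => by
    have := hlmin _ ⟨hc, rfl⟩; simp at this
  refine ⟨(Finset.Icc (G + 1 - l) (F - 1 - k)).image fun t => (-1, t), fun v hv => ?_, ?_⟩
  · obtain ⟨t, ht, rfl⟩ := Finset.mem_image.1 hv
    obtain ⟨ht1, ht2⟩ := Finset.mem_Icc.1 ht
    refine ⟨⟨by simp, (-1, 0), 0, by simp, fun s hs => ?_,
      ⟨_, hF, _, hG, ?_, by simp [dot], by simp [dot]⟩,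
      fun p hp hlt => h.convex _ fun w => ?_⟩, rfl⟩
    · simpa [dot] using h.nonneg s hs
    · simp only [ne_eq, Prod.mk.injEq, true_and]
      linarith
    · simp only [dot, neg_mul, one_mul, zero_mul, add_zero, neg_lt_zero] at hlt
      have b1 := line_bound hF hk hk' hp hlt
      have b2 := line_bound hG hl hl' hp hlt
      have b3 : p.2 + p.1 * t ≤ F := by nlinarith
      have b4 : G ≤ p.2 + p.1 * t := by nlinarith
      by_contra! hcon
      have c1 := hcon _ hF
      have c2 := hcon _ hG
      have c3 := hcon p hp
      simp only [dot, Prod.fst_add, Prod.snd_add] at c1 c2 c3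
      rcases le_total 0 w.2 with hw | hw
      · nlinarith [mul_le_mul_of_nonneg_left b3 hw]
      · nlinarith [mul_le_mul_of_nonpos_left b4 hw]
  · rw [Finset.card_image_of_injective _ (Prod.mk_right_injective _), Int.card_Icc]
    have c1 : {s ∈ S | s.1 = 0}.ncard ≤ (F + 1 - G).toNat := by
      rw [← Int.card_Icc, ← Set.ncard_coe_finset]
      refine Set.ncard_le_ncard_of_injOn Prod.snd (fun s hs => ?_) (fun s hs t ht hst => ?_)
        (Finset.finite_toSet _)
      · exact Finset.mem_coe.2 (Finset.mem_Icc.2 ⟨hGmin s hs, hFmax s hs⟩)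
      · exact Prod.ext (hs.2.trans ht.2.symm) hst
    have c2 : (k + 1 - l).toNat ≤ {i ∈ latInterior S | i.1 = 1}.ncard := by
      rw [← Int.card_Icc, ← Set.ncard_coe_finset]
      refine Set.ncard_le_ncard_of_injOn (fun y => (1, y)) (fun y hy => ⟨?_, rfl⟩)
        (Prod.mk_right_injective _).injOn hIf
      obtain ⟨hy1, hy2⟩ := Finset.mem_Icc.1 (Finset.mem_coe.1 hy)
      rcases hy2.eq_or_lt with rfl | hy2
      · exact hk
      · refine mem_latInterior_of_combination (a := k - y) (b := y - l) (c := 0) hl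
          (latInterior_subset h.convex hk) hF (by linarith) (by linarith) le_rfl ?_ ?_ <;>
          simp only <;> ring
    omega

theorem exists_right_columns (h : IsStrip S N) :
    ∃ C : Finset (ℤ × ℤ), (∀ v ∈ C, IsLatticeColumn S v ∧ v.1 = 1) ∧
      {s ∈ S | s.1 = N}.ncard ≤ {i ∈ latInterior S | i.1 = N - 1}.ncard + 1 + C.card := by
  classical
  obtain ⟨C, hC, hle⟩ := h.rotate.exists_left_columns
  have himage : ∀ (T : Set (ℤ × ℤ)) (k : ℤ),
      {s ∈ coordMap (-1, 0) (0, -1) (-N, 0) '' T | s.1 = k} =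
      coordMap (-1, 0) (0, -1) (-N, 0) '' {s ∈ T | s.1 = N - k} := by
    intro T k
    ext q
    obtain ⟨p, rfl⟩ := coordMap_surjective (c := (-N, 0)) rotate_det q
    simp only [Set.mem_ofPred_eq, (coordMap_injective rotate_det).mem_set_image]
    simp only [coordMap, dot]
    exact and_congr_right fun _ => ⟨fun h => by linarith, fun h => by linarith⟩
  rw [latInterior_image rotate_det, himage, himage,
    Set.ncard_image_of_injective _ (coordMap_injective rotate_det),
    Set.ncard_image_of_injective _ (coordMap_injective rotate_det), sub_zero] at hle
  refine ⟨C.image fun v => (-v.1, -v.2), fun v hv => ?_, ?_⟩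
  · obtain ⟨w, hw, rfl⟩ := Finset.mem_image.1 hv
    refine ⟨IsLatticeColumn.of_image (c := (-N, 0)) rotate_det ?_, by simp [(hC w hw).2]⟩
    simpa [coordMap, dot] using (hC w hw).1
  · rwa [Finset.card_image_of_injective]
    intro v w hvw
    simpa [Prod.ext_iff] using hvw

end IsStrip

theorem IsUpper.notMem_latInterior {S : Set (ℤ × ℤ)} {p : ℤ × ℤ} (hp : IsUpper S p) :
    p ∉ latInterior S := by
  obtain ⟨u, hu, hle⟩ := hp
  intro hI
  obtain ⟨s, hs, hlt⟩ := hI u (by rintro rfl; simp at hu)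
  exact absurd (hle s hs) (not_le.2 hlt)

theorem IsLower.notMem_latInterior {S : Set (ℤ × ℤ)} {p : ℤ × ℤ} (hp : IsLower S p) :
    p ∉ latInterior S := by
  obtain ⟨u, hu, hle⟩ := hp
  intro hI
  obtain ⟨s, hs, hlt⟩ := hI u (by rintro rfl; simp at hu)
  exact absurd (hle s hs) (not_le.2 hlt)

/-- A point that is both on the upper and on the lower boundary, with points on either side,
forces all of `S` onto a line. -/
theorem IsUpper.exists_dot_eq_of_isLower {S : Set (ℤ × ℤ)} {p a b : ℤ × ℤ} (hu : IsUpper S p)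
    (hl : IsLower S p) (ha : a ∈ S) (hb : b ∈ S) (hap : a.1 < p.1) (hpb : p.1 < b.1) :
    ∃ u : ℤ × ℤ, u ≠ 0 ∧ ∀ s ∈ S, dot u s = dot u p := by
  obtain ⟨u, hu0, hu⟩ := hu
  obtain ⟨w, hw0, hw⟩ := hl
  have key : ∀ s ∈ S, (u.2 * w.1 - w.2 * u.1) * (s.1 - p.1) ≤ 0 := by
    intro s hs
    have e1 := mul_le_mul_of_nonneg_left (hu s hs) (neg_pos.2 hw0).le
    have e2 := mul_le_mul_of_nonneg_left (hw s hs) hu0.le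
    simp only [dot] at e1 e2
    linarith
  have hD : u.2 * w.1 - w.2 * u.1 = 0 := by
    refine le_antisymm ?_ ?_
    · exact le_of_mul_le_mul_right (by simpa using key b hb) (sub_pos.2 hpb)
    · exact le_of_mul_le_mul_right (by linarith [key a ha]) (sub_pos.2 hap)
  refine ⟨u, by rintro rfl; simp at hu0, fun s hs => le_antisymm (hu s hs) ?_⟩
  have e := mul_le_mul_of_nonneg_left (hw s hs) hu0.le
  simp only [dot] at e ⊢
  refine le_of_mul_le_mul_left ?_ (neg_pos.2 hw0)
  linear_combination e + (p.1 - s.1) * hD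

namespace IsStrip

variable {S : Set (ℤ × ℤ)} {N : ℤ}

theorem ncard_diff_interior_le (h : IsStrip S N) : (S \ latInterior S).ncard ≤
    {s ∈ S | s.1 = 0}.ncard + {s ∈ S | s.1 = N}.ncard +
      {s ∈ S | 0 < s.1 ∧ s.1 < N ∧ IsUpper S s}.ncard +
      {s ∈ S | 0 < s.1 ∧ s.1 < N ∧ IsLower S s}.ncard := by
  have hfin := h.finite
  have hsub : S \ latInterior S ⊆ (({s ∈ S | s.1 = 0} ∪ {s ∈ S | s.1 = N}) ∪
      {s ∈ S | 0 < s.1 ∧ s.1 < N ∧ IsUpper S s}) ∪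
      {s ∈ S | 0 < s.1 ∧ s.1 < N ∧ IsLower S s} := by
    rintro p ⟨hp, hpI⟩
    simp only [latInterior, Set.mem_ofPred_eq, not_forall, not_exists, not_and, not_lt,
      exists_prop] at hpI
    obtain ⟨u, hu, hle⟩ := hpI
    rcases (h.nonneg p hp).eq_or_lt with h0 | h0
    · exact Or.inl (Or.inl (Or.inl ⟨hp, h0.symm⟩))
    rcases (h.le p hp).eq_or_lt with hN | hN
    · exact Or.inl (Or.inl (Or.inr ⟨hp, hN⟩))
    rcases lt_trichotomy u.2 0 with h2 | h2 | h2
    · exact Or.inr ⟨hp, h0, hN, u, h2, hle⟩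
    · exfalso
      obtain ⟨a, ha, ha0⟩ := h.exists_left
      obtain ⟨b, hb, hbN⟩ := h.exists_right
      have e1 := hle a ha
      have e2 := hle b hb
      simp only [dot, h2, ha0, hbN, zero_mul, add_zero, mul_zero] at e1 e2
      rcases lt_trichotomy u.1 0 with h1 | h1 | h1
      · nlinarith
      · exact hu (Prod.ext h1 h2)
      · nlinarith
    · exact Or.inl (Or.inr ⟨hp, h0, hN, u, h2, hle⟩)
  refine (Set.ncard_le_ncard hsub ((((hfin.sep _).union (hfin.sep _)).union (hfin.sep _)).union
    (hfin.sep _))).trans ((Set.ncard_union_le _ _).trans (Nat.add_le_add_right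
      ((Set.ncard_union_le _ _).trans (Nat.add_le_add_right (Set.ncard_union_le _ _) _)) _))

theorem le_ncard_interior_diff (h : IsStrip S N)
    (hnc : ∀ u : ℤ × ℤ, u ≠ 0 → ∀ c, ∃ i ∈ latInterior S, dot u i ≠ c) :
    {i ∈ latInterior S | i.1 = 1}.ncard + {i ∈ latInterior S | i.1 = N - 1}.ncard +
      {i ∈ latInterior S | 1 < i.1 ∧ i.1 < N - 1 ∧ IsUpper (latInterior S) i}.ncard +
      {i ∈ latInterior S | 1 < i.1 ∧ i.1 < N - 1 ∧ IsLower (latInterior S) i}.ncard ≤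
    (latInterior S \ latInterior (latInterior S)).ncard := by
  have hfin := h.interior_finite
  rw [← Set.ncard_union_eq ?_ (hfin.sep _) (hfin.sep _),
    ← Set.ncard_union_eq ?_ ((hfin.sep _).union (hfin.sep _)) (hfin.sep _),
    ← Set.ncard_union_eq ?_ (((hfin.sep _).union (hfin.sep _)).union (hfin.sep _)) (hfin.sep _)]
  · refine Set.ncard_le_ncard ?_ hfin.sdiff
    rintro i (((⟨hi, h1⟩ | ⟨hi, h1⟩) | ⟨hi, -, -, hu⟩) | ⟨hi, -, -, hl⟩)
    · refine ⟨hi, fun hJ => ?_⟩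
      obtain ⟨s, hs, hlt⟩ := hJ (-1, 0) (by simp)
      have := h.one_le hs
      simp only [dot] at hlt
      linarith
    · refine ⟨hi, fun hJ => ?_⟩
      obtain ⟨s, hs, hlt⟩ := hJ (1, 0) (by simp)
      have := h.le_sub_one hs
      simp only [dot] at hlt
      linarith
    · exact ⟨hi, hu.notMem_latInterior⟩
    · exact ⟨hi, hl.notMem_latInterior⟩
  · rw [Set.disjoint_left]
    rintro i ((⟨-, h1⟩ | ⟨-, h1⟩) | ⟨-, h1, h2, hu⟩) ⟨-, h3, h4, hl⟩
    · linarith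
    · linarith
    · obtain ⟨a, ha, ha1⟩ := h.exists_interior_left
      obtain ⟨b, hb, hb1⟩ := h.exists_interior_right
      obtain ⟨u, hu0, hueq⟩ := hu.exists_dot_eq_of_isLower hl ha hb (by linarith) (by linarith)
      obtain ⟨s, hs, hne⟩ := hnc u hu0 (dot u i)
      exact hne (hueq s hs)
  · rw [Set.disjoint_left]
    rintro i (⟨-, h1⟩ | ⟨-, h1⟩) ⟨-, h2, h3, -⟩ <;> linarith
  · rw [Set.disjoint_left]
    rintro i ⟨-, h1⟩ ⟨-, h2⟩
    linarith [h.three_le]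

theorem columnBound (h : IsStrip S N)
    (hnc : ∀ u : ℤ × ℤ, u ≠ 0 → ∀ c, ∃ i ∈ latInterior S, dot u i ≠ c) : ColumnBound S := by
  classical
  obtain ⟨C, hC, hCle⟩ := h.exists_left_columns
  obtain ⟨D, hD, hDle⟩ := h.exists_right_columns
  refine ⟨C ∪ D, fun v hv => ?_, ?_⟩
  · rcases Finset.mem_union.1 hv with hv | hv
    exacts [(hC v hv).1, (hD v hv).1]
  · rw [Finset.card_union_of_disjoint (Finset.disjoint_left.2 fun v hv hv' => by
      have := (hC v hv).2.symm.trans (hD v hv').2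
      norm_num at this)]
    have e1 := Set.ncard_sdiff_add_ncard_of_subset (latInterior_subset h.convex) h.finite
    have e2 := Set.ncard_sdiff_add_ncard_of_subset (latInterior_latInterior_subset S)
      h.interior_finite
    have e3 := h.ncard_diff_interior_le
    have e4 := h.le_ncard_interior_diff hnc
    have e5 := h.ncard_upper_le
    have e6 := h.ncard_lower_le
    omega

end IsStrip

/-! ### The standard triangles -/

/-- The lattice points of the standard triangle of size `D`. -/
def stdTriangle (D : ℕ) : Set (ℤ × ℤ) := {p | 0 ≤ p.1 ∧ 0 ≤ p.2 ∧ p.1 + p.2 ≤ D}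

theorem stdTriangle_finite (D : ℕ) : (stdTriangle D).Finite := by
  refine (Set.finite_Icc ((0, 0) : ℤ × ℤ) (D, D)).subset ?_
  rintro p ⟨h1, h2, h3⟩
  exact ⟨⟨h1, h2⟩, ⟨by simp only; linarith, by simp only; linarith⟩⟩

theorem stdTriangle_convex (D : ℕ) : LatticeConvex (stdTriangle D) := by
  intro p hp
  obtain ⟨s, ⟨h1, -, -⟩, h⟩ := hp (-1, 0)
  obtain ⟨t, ⟨-, h2, -⟩, h'⟩ := hp (0, -1)
  obtain ⟨r, ⟨-, -, h3⟩, h''⟩ := hp (1, 1)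
  simp only [dot] at h h' h''
  exact ⟨by linarith, by linarith, by linarith⟩

theorem mem_latInterior_stdTriangle {D : ℕ} {p : ℤ × ℤ} (h1 : 1 ≤ p.1) (h2 : 1 ≤ p.2)
    (h3 : p.1 + p.2 < D) : p ∈ latInterior (stdTriangle D) := by
  intro u hu
  by_contra! hcon
  have c1 := hcon (0, 0) ⟨le_rfl, le_rfl, by simp⟩
  have c2 := hcon (D, 0) ⟨by simp, le_rfl, by simp⟩
  have c3 := hcon (0, D) ⟨le_rfl, by simp, by simp⟩
  simp only [dot, mul_zero, zero_add, add_zero] at c1 c2 c3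
  have e0 : (D - p.1 - p.2) * (u.1 * p.1 + u.2 * p.2) ≤ 0 := by
    nlinarith [mul_le_mul_of_nonneg_left c2 (zero_le_one.trans h1),
      mul_le_mul_of_nonneg_left c3 (zero_le_one.trans h2)]
  have e1 : u.1 * p.1 + u.2 * p.2 = 0 := le_antisymm (by nlinarith) c1
  rw [e1] at c2 c3
  have hD : (0 : ℤ) < D := by linarith
  have u1 : u.1 ≤ 0 := le_of_mul_le_mul_right (by linarith) hD
  have u2 : u.2 ≤ 0 := le_of_mul_le_mul_right (by linarith) hD
  have v1 : u.1 = 0 := le_antisymm u1 (by nlinarith)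
  have v2 : u.2 = 0 := le_antisymm u2 (by nlinarith)
  exact hu (Prod.ext v1 v2)

theorem of_mem_latInterior_stdTriangle {D : ℕ} {p : ℤ × ℤ}
    (hp : p ∈ latInterior (stdTriangle D)) : 1 ≤ p.1 ∧ 1 ≤ p.2 ∧ p.1 + p.2 < D := by
  obtain ⟨s, ⟨h1, -, -⟩, h⟩ := hp (-1, 0) (by simp)
  obtain ⟨t, ⟨-, h2, -⟩, h'⟩ := hp (0, -1) (by simp)
  obtain ⟨r, ⟨-, -, h3⟩, h''⟩ := hp (1, 1) (by simp)
  simp only [dot] at h h' h''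
  exact ⟨by linarith, by linarith, by linarith⟩

theorem ncard_stdTriangle_diff_interior_le {D : ℕ} (hD : 0 < D) :
    (stdTriangle D \ latInterior (stdTriangle D)).ncard ≤ 3 * D := by
  classical
  have hsub : stdTriangle D \ latInterior (stdTriangle D) ⊆
      ((Finset.range D).image (fun i : ℕ => ((i : ℤ), (0 : ℤ))) ∪
        (Finset.range D).image (fun i : ℕ => ((D - i : ℤ), (i : ℤ))) ∪
        (Finset.range D).image (fun i : ℕ => ((0 : ℤ), (D - i : ℤ))) : Finset (ℤ × ℤ)) := by
    rintro ⟨x, y⟩ ⟨⟨h1, h2, h3⟩, hI⟩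
    have hb : x = 0 ∨ y = 0 ∨ x + y = D := by
      by_contra! hcon
      exact hI (mem_latInterior_stdTriangle (by simp only at *; omega) (by simp only at *; omega)
        (by simp only at *; omega))
    simp only [Finset.coe_union, Finset.coe_image, Set.mem_union, Set.mem_image,
      Finset.coe_range, Set.mem_Iio, Prod.mk.injEq] at h1 h2 h3 ⊢
    by_cases hx : x = 0 ∧ 0 < y
    · exact Or.inr ⟨D - y.toNat, by omega, by omega, by omega⟩
    by_cases hxy : x + y = D
    · exact Or.inl (Or.inr ⟨y.toNat, by omega, by omega, by omega⟩)
    · exact Or.inl (Or.inl ⟨x.toNat, by omega, by omega, by omega⟩)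
  refine (Set.ncard_le_ncard hsub (Finset.finite_toSet _)).trans ?_
  rw [Set.ncard_coe_finset]
  refine (Finset.card_union_le _ _).trans ?_
  have h1 := Finset.card_union_le ((Finset.range D).image (fun i : ℕ => ((i : ℤ), (0 : ℤ))))
    ((Finset.range D).image (fun i : ℕ => ((D - i : ℤ), (i : ℤ))))
  have h2 : ∀ f : ℕ → ℤ × ℤ, ((Finset.range D).image f).card ≤ D := fun f =>
    Finset.card_image_le.trans (Finset.card_range D).le
  linarith [h2 (fun i : ℕ => ((i : ℤ), (0 : ℤ))), h2 (fun i : ℕ => ((D - i : ℤ), (i : ℤ))),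
    h2 (fun i : ℕ => ((0 : ℤ), (D - i : ℤ)))]

theorem le_ncard_interior_stdTriangle_diff (D : ℕ) :
    3 * (D - 3) ≤ (latInterior (stdTriangle D) \
      latInterior (latInterior (stdTriangle D))).ncard := by
  classical
  have hsub : (((Finset.range (D - 3)).image (fun i : ℕ => ((1 + i : ℤ), (1 : ℤ))) ∪
        (Finset.range (D - 3)).image (fun i : ℕ => ((D - 2 - i : ℤ), (1 + i : ℤ))) ∪
        (Finset.range (D - 3)).image (fun i : ℕ => ((1 : ℤ), (D - 2 - i : ℤ))) :
          Finset (ℤ × ℤ)) : Set (ℤ × ℤ)) ⊆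
      latInterior (stdTriangle D) \ latInterior (latInterior (stdTriangle D)) := by
    rintro ⟨x, y⟩ h
    simp only [Finset.coe_union, Finset.coe_image, Set.mem_union, Set.mem_image,
      Finset.coe_range, Set.mem_Iio, Prod.mk.injEq] at h
    have hb : (x = 1 ∨ y = 1 ∨ x + y = D - 1) ∧ 1 ≤ x ∧ 1 ≤ y ∧ x + y < D := by
      rcases h with (⟨i, hi, rfl, rfl⟩ | ⟨i, hi, rfl, rfl⟩) | ⟨i, hi, rfl, rfl⟩ <;> omega
    refine ⟨mem_latInterior_stdTriangle hb.2.1 hb.2.2.1 hb.2.2.2, fun hJ => ?_⟩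
    obtain ⟨s, hs, h1⟩ := hJ (-1, 0) (by simp)
    obtain ⟨t, ht, h2⟩ := hJ (0, -1) (by simp)
    obtain ⟨r, hr, h3⟩ := hJ (1, 1) (by simp)
    have := of_mem_latInterior_stdTriangle hs
    have := of_mem_latInterior_stdTriangle ht
    have := of_mem_latInterior_stdTriangle hr
    simp only [dot] at h1 h2 h3
    omega
  refine le_trans ?_ (Set.ncard_le_ncard hsub
    ((stdTriangle_finite D).subset (latInterior_subset (stdTriangle_convex D))).sdiff)
  rw [Set.ncard_coe_finset, Finset.card_union_of_disjoint, Finset.card_union_of_disjoint,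
    Finset.card_image_of_injective, Finset.card_image_of_injective,
    Finset.card_image_of_injective, Finset.card_range]
  · linarith
  · intro i j hij; simpa using hij
  · intro i j hij; simp only [Prod.mk.injEq] at hij; omega
  · intro i j hij; simp only [Prod.mk.injEq] at hij; omega
  · rw [Finset.disjoint_left]
    simp only [Finset.mem_image, Finset.mem_range, not_exists, not_and, forall_exists_index,
      and_imp, forall_apply_eq_imp_iff₂, Prod.mk.injEq]
    omega
  · rw [Finset.disjoint_left]
    simp only [Finset.mem_union, Finset.mem_image, Finset.mem_range]
    rintro _ (⟨i, hi, rfl⟩ | ⟨i, hi, rfl⟩) ⟨j, hj, hij⟩ <;> simp only [Prod.mk.injEq] at hij <;>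
      omega

theorem stdTriangle_columnBound {D : ℕ} (hD : 0 < D) : ColumnBound (stdTriangle D) := by
  classical
  have m00 : (0, 0) ∈ stdTriangle D := ⟨le_rfl, le_rfl, by simp⟩
  have m10 : ((D : ℤ), 0) ∈ stdTriangle D := ⟨by simp, le_rfl, by simp⟩
  have m01 : (0, (D : ℤ)) ∈ stdTriangle D := ⟨le_rfl, by simp, by simp⟩
  refine ⟨{(-1, 0), (-1, 1), (0, -1)}, fun v hv => ?_, ?_⟩
  · simp only [Finset.mem_insert, Finset.mem_singleton] at hv
    have hleft : ∀ t : ℤ, 0 ≤ t → t ≤ 1 → IsLatticeColumn (stdTriangle D) (-1, t) := by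
      intro t ht0 ht1
      refine ⟨by simp, (-1, 0), 0, by simp, fun s hs => ?_,
        ⟨_, m00, _, m01, ?_, by simp [dot], by simp [dot]⟩, fun p hp hlt => ?_⟩
      · simpa [dot] using hs.1
      · simp only [ne_eq, Prod.mk.injEq]; omega
      · obtain ⟨h1, h2, h3⟩ := hp
        simp only [dot] at hlt
        refine ⟨?_, ?_, ?_⟩ <;> simp only [Prod.fst_add, Prod.snd_add] <;> linarith
    rcases hv with rfl | rfl | rfl
    · exact hleft 0 le_rfl zero_le_one
    · exact hleft 1 zero_le_one le_rfl
    · refine ⟨by simp, (0, -1), 0, by simp, fun s hs => ?_,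
        ⟨_, m00, _, m10, ?_, by simp [dot], by simp [dot]⟩, fun p hp hlt => ?_⟩
      · simpa [dot] using hs.2.1
      · simp only [ne_eq, Prod.mk.injEq]; omega
      · obtain ⟨h1, h2, h3⟩ := hp
        simp only [dot] at hlt
        refine ⟨?_, ?_, ?_⟩ <;> simp only [Prod.fst_add, Prod.snd_add] <;> linarith
  · have hI := latInterior_subset (stdTriangle_convex D)
    have e1 := Set.ncard_sdiff_add_ncard_of_subset hI (stdTriangle_finite D)
    have e2 := Set.ncard_sdiff_add_ncard_of_subset
      (latInterior_latInterior_subset (stdTriangle D)) ((stdTriangle_finite D).subset hI)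
    have e3 := ncard_stdTriangle_diff_interior_le hD
    have e4 := le_ncard_interior_stdTriangle_diff D
    have e5 : ({(-1, 0), (-1, 1), (0, -1)} : Finset (ℤ × ℤ)).card = 3 := by decide
    omega

/-! ### Functionals at height one and corners -/

/-- Some interior point is one step away from the minimum of the functional `u` over `S`. -/
def HeightOne (S : Set (ℤ × ℤ)) (u : ℤ × ℤ) : Prop :=
  ∃ p ∈ S, (∀ s ∈ S, dot u p ≤ dot u s) ∧ ∃ i ∈ latInterior S, dot u i = dot u p + 1

/-- In the coordinates given by `A` and `B`, the set `S` has a corner at `p` next to which there is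
the interior point `(1, 1)`. -/
structure IsLatticeCorner (S : Set (ℤ × ℤ)) (A B p : ℤ × ℤ) : Prop where
  det : A.1 * B.2 - A.2 * B.1 = 1
  mem : p ∈ S
  le_left : ∀ s ∈ S, dot A p ≤ dot A s
  le_right : ∀ s ∈ S, dot B p ≤ dot B s
  exists_interior : ∃ i ∈ latInterior S, dot A i = dot A p + 1 ∧ dot B i = dot B p + 1

section corner

variable {S : Set (ℤ × ℤ)}

theorem dot_lt_of_mem_latInterior {u p i : ℤ × ℤ} (hu : u ≠ 0) (hi : i ∈ latInterior S)
    (hp : ∀ s ∈ S, dot u p ≤ dot u s) : dot u p < dot u i := by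
  obtain ⟨s, hs, hlt⟩ := hi (-u) (neg_ne_zero.2 hu)
  have := hp s hs
  simp only [dot, Prod.fst_neg, Prod.snd_neg] at *
  linarith

theorem eq_and_eq_of_dot_eq {A B : ℤ × ℤ} (h : A.1 * B.2 - A.2 * B.1 ≠ 0) {x y : ℤ}
    (h1 : A.1 * x + A.2 * y = 0) (h2 : B.1 * x + B.2 * y = 0) : x = 0 ∧ y = 0 := by
  constructor
  · refine (mul_eq_zero.1 (?_ : (A.1 * B.2 - A.2 * B.1) * x = 0)).resolve_left h
    linear_combination B.2 * h1 - A.2 * h2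
  · refine (mul_eq_zero.1 (?_ : (A.1 * B.2 - A.2 * B.1) * y = 0)).resolve_left h
    linear_combination A.1 * h2 - B.1 * h1

/-- If an interior point `i` lies above the diagonal through `p` and a point `s` below it, then
the first point `q` of the diagonal is interior. -/
theorem mem_latInterior_of_diagonal {A B p i s q : ℤ × ℤ} (hdet : A.1 * B.2 - A.2 * B.1 ≠ 0)
    (hp : p ∈ S) (hi : i ∈ latInterior S) (hs : s ∈ S)
    (hqA : dot A q = dot A p + 1) (hqB : dot B q = dot B p + 1)
    {x y a b : ℤ} (hx : dot A i = dot A p + x) (hy : dot B i = dot B p + y)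
    (ha : dot A s = dot A p + a) (hb : dot B s = dot B p + b) (hxy : x ≤ y) (hab : b < a)
    (hX : (a - b) + (y - x) ≤ (a - b) * x + (y - x) * a) : q ∈ latInterior S := by
  have key := eq_and_eq_of_dot_eq hdet
    (x := ((a - b) * x + (y - x) * a) * q.1 - ((a - b) * i.1 + (y - x) * s.1 +
      ((a - b) * x + (y - x) * a - (a - b) - (y - x)) * p.1))
    (y := ((a - b) * x + (y - x) * a) * q.2 - ((a - b) * i.2 + (y - x) * s.2 +
      ((a - b) * x + (y - x) * a - (a - b) - (y - x)) * p.2))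
    (by
      simp only [dot] at *
      linear_combination ((a - b) * x + (y - x) * a) * hqA - (a - b) * hx - (y - x) * ha)
    (by
      simp only [dot] at *
      linear_combination ((a - b) * x + (y - x) * a) * hqB - (a - b) * hy - (y - x) * hb)
  exact mem_latInterior_of_combination (a := a - b) (b := y - x)
    (c := (a - b) * x + (y - x) * a - (a - b) - (y - x)) hi hs hp (sub_pos.2 hab)
    (sub_nonneg.2 hxy) (by linarith) (by linear_combination key.1) (by linear_combination key.2)

theorem exists_dot_eq {A B : ℤ × ℤ} (h : A.1 * B.2 - A.2 * B.1 = 1) (x y : ℤ) :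
    ∃ q, dot A q = x ∧ dot B q = y := by
  obtain ⟨q, hq⟩ := coordMap_surjective (c := 0) h (x, y)
  simp only [coordMap, Prod.fst_zero, Prod.snd_zero, sub_zero, Prod.mk.injEq] at hq
  exact ⟨q, hq⟩

theorem exists_isLatticeCorner_of_le {p i : ℤ × ℤ} (hp : p ∈ S) (hi : i ∈ latInterior S) (k : ℕ) :
    ∀ (A B : ℤ × ℤ) (n m : ℤ), A.1 * B.2 - A.2 * B.1 = 1 → (∀ s ∈ S, dot A p ≤ dot A s) →
      (∀ s ∈ S, dot B p ≤ dot B s) → 1 ≤ n → 1 ≤ m →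
      dot A i - dot A p + (dot B i - dot B p) ≤ k →
      ∃ (A' B' : ℤ × ℤ) (n' m' : ℤ), IsLatticeCorner S A' B' p ∧ 1 ≤ n' ∧ 1 ≤ m' ∧
        (n * A.1 + m * B.1, n * A.2 + m * B.2) =
          (n' * A'.1 + m' * B'.1, n' * A'.2 + m' * B'.2) := by
  induction k with
  | zero =>
    intro A B n m hdet hA hB _ _ hle
    have hA0 : A ≠ 0 := by rintro rfl; simp at hdet
    have hB0 : B ≠ 0 := by rintro rfl; simp at hdet
    have := dot_lt_of_mem_latInterior hA0 hi hA
    have := dot_lt_of_mem_latInterior hB0 hi hB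
    push_cast at hle
    linarith
  | succ k ih =>
    intro A B n m hdet hA hB hn hm hle
    have hA0 : A ≠ 0 := by rintro rfl; simp at hdet
    have hB0 : B ≠ 0 := by rintro rfl; simp at hdet
    have hx := dot_lt_of_mem_latInterior hA0 hi hA
    have hy := dot_lt_of_mem_latInterior hB0 hi hB
    obtain ⟨q, hqA, hqB⟩ := exists_dot_eq hdet (dot A p + 1) (dot B p + 1)
    push_cast at hle
    by_cases hq : q ∈ latInterior S
    · exact ⟨A, B, n, m, ⟨hdet, hp, hA, hB, q, hq, hqA, hqB⟩, hn, hm, rfl⟩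
    have hdet' : B.1 * A.2 - B.2 * A.1 ≠ 0 := by
      rw [show B.1 * A.2 - B.2 * A.1 = -1 by linear_combination -hdet]; norm_num
    rcases le_total (dot A i - dot A p) (dot B i - dot B p) with hxy | hxy
    · have hBA : ∀ s ∈ S, dot A s - dot A p ≤ dot B s - dot B p := by
        intro s hs
        by_contra! hcon
        refine hq (mem_latInterior_of_diagonal (hdet ▸ one_ne_zero) hp hi hs hqA hqB
          (add_sub_cancel _ _).symm (add_sub_cancel _ _).symm
          (add_sub_cancel _ _).symm (add_sub_cancel _ _).symm hxy hcon ?_)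
        have := hB s hs
        nlinarith
      obtain ⟨A', B', n', m', hc, hn', hm', heq⟩ := ih A (B.1 - A.1, B.2 - A.2) (n + m) m
        (by simp only; linear_combination hdet) hA
        (fun s hs => by have := hBA s hs; simp only [dot] at *; linarith)
        (by linarith) hm (by simp only [dot] at *; linarith)
      refine ⟨A', B', n', m', hc, hn', hm', heq ▸ Prod.ext ?_ ?_⟩ <;> simp only <;> ring
    · have hAB : ∀ s ∈ S, dot B s - dot B p ≤ dot A s - dot A p := by
        intro s hs
        by_contra! hcon
        refine hq (mem_latInterior_of_diagonal hdet' hp hi hs hqB hqA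
          (add_sub_cancel _ _).symm (add_sub_cancel _ _).symm
          (add_sub_cancel _ _).symm (add_sub_cancel _ _).symm hxy hcon ?_)
        have := hA s hs
        nlinarith
      obtain ⟨A', B', n', m', hc, hn', hm', heq⟩ := ih (A.1 - B.1, A.2 - B.2) B n (n + m)
        (by simp only; linear_combination hdet)
        (fun s hs => by have := hAB s hs; simp only [dot] at *; linarith) hB
        hn (by linarith) (by simp only [dot] at *; linarith)
      refine ⟨A', B', n', m', hc, hn', hm', heq ▸ Prod.ext ?_ ?_⟩ <;> simp only <;> ring

/-- A primitive functional is at height one, or a positive combination of the two functionals of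
a corner. -/
theorem heightOne_or_exists_isLatticeCorner (hS : S.Finite) (hSc : LatticeConvex S)
    {i : ℤ × ℤ} (hi : i ∈ latInterior S) {u w : ℤ × ℤ} (hdet : w.1 * u.2 - w.2 * u.1 = 1) :
    HeightOne S u ∨ ∃ (A B p : ℤ × ℤ) (n m : ℤ), IsLatticeCorner S A B p ∧ 1 ≤ n ∧ 1 ≤ m ∧
      u = (n * A.1 + m * B.1, n * A.2 + m * B.2) := by
  rw [or_iff_not_imp_left]
  intro hno
  have hu : u ≠ 0 := by rintro rfl; simp at hdet
  obtain ⟨p, hp, hmin⟩ := Set.exists_min_image S (dot u) hS ⟨i, latInterior_subset hSc hi⟩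
  have hno' : ∀ q ∈ latInterior S, dot u q ≠ dot u p + 1 := fun q hq h =>
    hno ⟨p, hp, hmin, q, hq, h⟩
  have hx := dot_lt_of_mem_latInterior hu hi hmin
  obtain ⟨x, hx'⟩ : ∃ x, x = dot u i - dot u p := ⟨_, rfl⟩
  obtain ⟨y, hy'⟩ : ∃ y, y = dot w i - dot w p := ⟨_, rfl⟩
  have hx0 : 0 < x := by linarith
  obtain ⟨j, hj⟩ : ∃ j, j = y / x := ⟨_, rfl⟩
  obtain ⟨e, he⟩ : ∃ e, e = y % x := ⟨_, rfl⟩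
  have hye : y = e + x * j := by rw [he, hj]; exact (Int.emod_add_mul_ediv y x).symm
  have he0 : 0 ≤ e := he ▸ Int.emod_nonneg _ hx0.ne'
  have hex : e < x := he ▸ Int.emod_lt_of_pos _ hx0
  have ha : ∀ s ∈ S, dot (w.1 - j * u.1, w.2 - j * u.2) p ≤
      dot (w.1 - j * u.1, w.2 - j * u.2) s := by
    intro s hs
    by_contra! hcon
    obtain ⟨q, hqw, hqu⟩ := exists_dot_eq hdet (dot w p + j) (dot u p + 1)
    refine hno' q (mem_latInterior_of_diagonal (A := u)
      (B := (w.1 - (j - 1) * u.1, w.2 - (j - 1) * u.2)) (x := x) (y := x + e)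
      (a := dot u s - dot u p) (b := dot w s - dot w p - (j - 1) * (dot u s - dot u p))
      ?_ hp hi hs hqu ?_ (by linarith) ?_ (by ring) ?_ (by linarith) ?_ ?_) hqu
    · exact ne_of_eq_of_ne (b := -1) (by linear_combination -hdet) (by norm_num)
    · simp only [dot] at *; linear_combination hqw - (j - 1) * hqu
    · simp only [dot] at *; linear_combination hye - hy' + (j - 1) * hx'
    · simp only [dot] at *; ring
    · simp only [dot] at *; linarith
    · have h1 := hmin s hs
      have h2 : 1 ≤ dot u s - dot u p - (dot w s - dot w p - (j - 1) * (dot u s - dot u p)) := by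
        simp only [dot] at *; linarith
      nlinarith
  have hane : (w.1 - j * u.1, w.2 - j * u.2) ≠ (0 : ℤ × ℤ) := by
    intro h0
    obtain ⟨h1, h2⟩ := Prod.ext_iff.1 h0
    simp only [Prod.fst_zero, Prod.snd_zero] at h1 h2
    exact one_ne_zero (hdet.symm.trans (by linear_combination u.2 * h1 - u.1 * h2))
  have he1 : 0 < e := by
    have := dot_lt_of_mem_latInterior hane hi ha
    have he' : e = dot w i - dot w p - j * (dot u i - dot u p) := by
      linear_combination hy' - hye - j * hx'
    simp only [dot] at *
    linarith
  have hb : ∀ s ∈ S, dot ((j + 1) * u.1 - w.1, (j + 1) * u.2 - w.2) p ≤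
      dot ((j + 1) * u.1 - w.1, (j + 1) * u.2 - w.2) s := by
    intro s hs
    by_contra! hcon
    obtain ⟨q, hqw, hqu⟩ := exists_dot_eq hdet (dot w p + j + 1) (dot u p + 1)
    refine hno' q (mem_latInterior_of_diagonal (A := (w.1 - j * u.1, w.2 - j * u.2))
      (B := u) (x := e) (y := x)
      (a := dot w s - dot w p - j * (dot u s - dot u p)) (b := dot u s - dot u p)
      ?_ hp hi hs ?_ hqu ?_ (by linarith) ?_ (by ring) hex.le ?_ ?_) hqu
    · exact ne_of_eq_of_ne (b := 1) (by linear_combination hdet) (by norm_num)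
    · simp only [dot] at *; linear_combination hqw - j * hqu
    · simp only [dot] at *; linear_combination hye - hy' + j * hx'
    · simp only [dot] at *; ring
    · simp only [dot] at *; linarith
    · have h1 := hmin s hs
      have h2 : 1 ≤ dot w s - dot w p - j * (dot u s - dot u p) - (dot u s - dot u p) := by
        simp only [dot] at *; linarith
      nlinarith
  obtain ⟨A, B, n, m, hc, hn, hm, heq⟩ := exists_isLatticeCorner_of_le hp hi _
    (w.1 - j * u.1, w.2 - j * u.2) ((j + 1) * u.1 - w.1, (j + 1) * u.2 - w.2) 1 1
    (by simp only; linear_combination hdet) ha hb le_rfl le_rfl (Int.self_le_toNat _)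
  refine ⟨A, B, p, n, m, hc, hn, hm, heq ▸ Prod.ext ?_ ?_⟩ <;> simp only <;> ring

end corner

/-- No line contains `S`. -/
def Noncollinear (S : Set (ℤ × ℤ)) : Prop := ∀ u : ℤ × ℤ, u ≠ 0 → ∀ c, ∃ s ∈ S, dot u s ≠ c

section selection

variable {S : Set (ℤ × ℤ)}

theorem Noncollinear.image (hS : Noncollinear S) {A B c : ℤ × ℤ}
    (h : A.1 * B.2 - A.2 * B.1 = 1) : Noncollinear (coordMap A B c '' S) := by
  intro u hu d
  obtain ⟨s, hs, hne⟩ := hS _ (pullback_ne_zero h hu) (d + dot u c)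
  exact ⟨_, ⟨s, hs, rfl⟩, fun hc => hne (by rw [dot_coordMap] at hc; linarith)⟩

theorem heightOne_image {A B c : ℤ × ℤ} (h : A.1 * B.2 - A.2 * B.1 = 1) {u : ℤ × ℤ} :
    HeightOne (coordMap A B c '' S) u ↔
      HeightOne S (u.1 * A.1 + u.2 * B.1, u.1 * A.2 + u.2 * B.2) := by
  simp only [HeightOne, latInterior_image h, Set.exists_mem_image, Set.forall_mem_image,
    dot_coordMap, sub_le_sub_iff_right, sub_add_eq_add_sub, sub_left_inj]

theorem IsLatticeCorner.not_heightOne {A B p : ℤ × ℤ} (hc : IsLatticeCorner S A B p) {k l : ℤ}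
    (hk : 1 ≤ k) (hl : 1 ≤ l) {u : ℤ × ℤ} (h1 : u.1 = k * A.1 + l * B.1)
    (h2 : u.2 = k * A.2 + l * B.2) : ¬ HeightOne S u := by
  rintro ⟨q, hq, hqmin, i, hi, hqi⟩
  have hu : ∀ s, dot u s = k * dot A s + l * dot B s := by
    intro s; simp only [dot, h1, h2]; ring
  have hA : A ≠ 0 := by rintro rfl; simpa using hc.det
  have hB : B ≠ 0 := by rintro rfl; simpa using hc.det
  have e1 := dot_lt_of_mem_latInterior hA hi hc.le_left
  have e2 := dot_lt_of_mem_latInterior hB hi hc.le_right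
  have e3 := hqmin p hc.mem
  rw [hu, hu] at e3 hqi
  nlinarith

theorem columnBound_of_heightOne_neg (hS : S.Finite) (hSc : LatticeConvex S)
    (hnc : Noncollinear (latInterior S)) {u w : ℤ × ℤ} (hdet : u.1 * w.2 - u.2 * w.1 = 1)
    (h1 : HeightOne S u) (h2 : HeightOne S (-u)) : ColumnBound S := by
  obtain ⟨p, hp, hpmin, i, hi, hpi⟩ := h1
  obtain ⟨q, hq, hqmin, j, hj, hqj⟩ := h2
  have hu0 : u ≠ 0 := by rintro rfl; simp at hdet
  have hneg : ∀ s, dot (-u) s = -dot u s := by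
    intro s; simp only [dot, Prod.fst_neg, Prod.snd_neg]; ring
  simp only [hneg, neg_le_neg_iff] at hqmin hqj
  have hi2 := dot_lt_of_mem_latInterior (p := q) (neg_ne_zero.2 hu0) hi
    (fun s hs => by simpa [hneg] using hqmin s hs)
  rw [hneg, hneg] at hi2
  have hstrip : IsStrip (coordMap u w (dot u p, 0) '' S) (dot u q - dot u p) := by
    refine ⟨hS.image _, hSc.image hdet, ?_, ?_, ?_, ?_, ?_, ?_, ?_⟩
    · rintro _ ⟨s, hs, rfl⟩
      simpa [coordMap] using hpmin s hs
    · rintro _ ⟨s, hs, rfl⟩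
      simpa [coordMap] using hqmin s hs
    · exact ⟨_, ⟨p, hp, rfl⟩, by simp [coordMap]⟩
    · exact ⟨_, ⟨q, hq, rfl⟩, by simp [coordMap]⟩
    · rw [latInterior_image hdet]
      exact ⟨_, ⟨i, hi, rfl⟩, by simp [coordMap, hpi]⟩
    · rw [latInterior_image hdet]
      exact ⟨_, ⟨j, hj, rfl⟩, by simp only [coordMap]; linarith⟩
    · by_contra! hlt
      obtain ⟨k, hk, hne⟩ := hnc u hu0 (dot u p + 1)
      have hk1 := dot_lt_of_mem_latInterior hu0 hk hpmin
      have hk2 := dot_lt_of_mem_latInterior (p := q) (neg_ne_zero.2 hu0) hk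
        (fun s hs => by simpa [hneg] using hqmin s hs)
      rw [hneg, hneg] at hk2
      omega
  refine ColumnBound.of_image hdet (hstrip.columnBound ?_)
  rw [latInterior_image hdet]
  exact hnc.image hdet

theorem eq_stdTriangle (hSc : LatticeConvex S) {D : ℕ} (h0 : (0, 0) ∈ S) (h1 : ((D : ℤ), 0) ∈ S)
    (h2 : (0, (D : ℤ)) ∈ S) (hsub : S ⊆ stdTriangle D) : S = stdTriangle D := by
  refine hsub.antisymm ?_
  rintro p ⟨hx, hy, hxy⟩
  refine hSc p fun u => ?_
  by_contra! hcon
  have c0 := hcon _ h0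
  have c1 := hcon _ h1
  have c2 := hcon _ h2
  simp only [dot, mul_zero, zero_add, add_zero] at c0 c1 c2
  rcases hx.eq_or_lt with hx | hx
  · rw [← hx, mul_zero, zero_add] at c0 c2
    have hu : 0 < u.2 := pos_of_mul_pos_left c0 hy
    nlinarith
  · nlinarith [mul_lt_mul_of_pos_left c1 hx, mul_le_mul_of_nonneg_left c2.le hy]

/-- If a corner presents `(-1, 0)` as a positive combination while `(0, 1)` and `(-n, -m)` are at
height one, then its functionals are `(0, 1)` and `(-1, -k)`. -/
theorem IsLatticeCorner.eq_of_left {A B p : ℤ × ℤ} {k a n m : ℤ} (hc : IsLatticeCorner S A B p)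
    (hk : 1 ≤ k) (ha : 1 ≤ a) (heq : (-1, 0) = (k * A.1 + a * B.1, k * A.2 + a * B.2))
    (hn : 1 ≤ n) (hm : 1 ≤ m) (hbot : HeightOne S (0, 1)) (hnm : HeightOne S (-n, -m)) :
    A = (0, 1) ∧ B = (-1, -k) := by
  obtain ⟨hk1, hk2⟩ := Prod.ext_iff.1 heq
  simp only at hk1 hk2
  have hd := hc.det
  have hA2 : A.2 = a := by linear_combination A.1 * hk2 - A.2 * hk1 + a * hd
  have hB2 : B.2 = -k := by linear_combination B.1 * hk2 - B.2 * hk1 - k * hd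
  have hA1 : A.1 ≤ 0 := by
    by_contra! hpos
    have hB1 : B.1 < 0 := by
      by_contra! hB1
      linarith [mul_pos (zero_lt_one.trans_le hk) hpos, mul_nonneg (zero_le_one.trans ha) hB1]
    exact hc.not_heightOne (k := -B.1) (l := A.1) (by linarith) hpos
      (by simp only; ring) (by simp only; linear_combination -hd) hbot
  have hB1 : B.1 < 0 := by
    by_contra! hneg
    refine hc.not_heightOne (k := n * k + m * B.1) (l := n * a - m * A.1) ?_ ?_ ?_ ?_ hnm
    · nlinarith
    · nlinarith
    · simp only; linear_combination n * hk1
    · simp only; linear_combination n * hk2 + m * hd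
  have hA1' : A.1 = 0 := by nlinarith
  rw [hA1', mul_zero, zero_add] at hk1
  have hB1' : B.1 = -1 := by nlinarith
  have ha1 : a = 1 := by rw [hB1'] at hk1; linarith
  exact ⟨Prod.ext hA1' (hA2.trans ha1), Prod.ext hB1' hB2⟩

/-- If a corner presents `(0, -1)` as a positive combination while `(1, 0)` and `(-n, -m)` are at
height one, then its functionals are `(-l, -1)` and `(1, 0)`. -/
theorem IsLatticeCorner.eq_of_bottom {A B p : ℤ × ℤ} {b l n m : ℤ} (hc : IsLatticeCorner S A B p)
    (hb : 1 ≤ b) (hl : 1 ≤ l) (heq : (0, -1) = (b * A.1 + l * B.1, b * A.2 + l * B.2))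
    (hn : 1 ≤ n) (hm : 1 ≤ m) (hleft : HeightOne S (1, 0)) (hnm : HeightOne S (-n, -m)) :
    A = (-l, -1) ∧ B = (1, 0) := by
  obtain ⟨hl1, hl2⟩ := Prod.ext_iff.1 heq
  simp only at hl1 hl2
  have hd := hc.det
  have hB1 : B.1 = b := by linear_combination B.2 * hl1 - B.1 * hl2 + b * hd
  have hA1 : A.1 = -l := by linear_combination A.2 * hl1 - A.1 * hl2 - l * hd
  have hB2 : B.2 ≤ 0 := by
    by_contra! hpos
    have hA2 : A.2 < 0 := by
      by_contra! hA2
      linarith [mul_pos (zero_lt_one.trans_le hl) hpos, mul_nonneg (zero_le_one.trans hb) hA2]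
    exact hc.not_heightOne (k := B.2) (l := -A.2) hpos (by linarith)
      (by simp only; linear_combination -hd) (by simp only; ring) hleft
  have hA2 : A.2 < 0 := by
    by_contra! hneg
    refine hc.not_heightOne (k := m * b - n * B.2) (l := m * l + n * A.2) ?_ ?_ ?_ ?_ hnm
    · nlinarith
    · nlinarith
    · simp only; linear_combination m * hl1 + n * hd
    · simp only; linear_combination m * hl2
  have hB2' : B.2 = 0 := by nlinarith
  rw [hB2', mul_zero, add_zero] at hl2
  have hA2' : A.2 = -1 := by nlinarith
  have hb1 : b = 1 := by rw [hA2'] at hl2; linarith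
  exact ⟨Prod.ext hA1 hA2', Prod.ext (hB1.trans hb1) hB2'⟩

/-- The case of a corner at the origin, opposite to a functional at height one. -/
theorem columnBound_of_isLatticeCorner (hS : S.Finite) (hSc : LatticeConvex S)
    (hnc : Noncollinear (latInterior S)) (hc : IsLatticeCorner S (1, 0) (0, 1) 0) {n m : ℤ}
    (hn : 1 ≤ n) (hm : 1 ≤ m) (hnm : HeightOne S (-n, -m)) : ColumnBound S := by
  obtain ⟨i, hi, hi1, hi2⟩ := hc.exists_interior
  have hleft : HeightOne S (1, 0) := ⟨0, hc.mem, hc.le_left, i, hi, hi1⟩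
  have hbot : HeightOne S (0, 1) := ⟨0, hc.mem, hc.le_right, i, hi, hi2⟩
  have hx := hc.le_left
  have hy := hc.le_right
  simp only [dot, Prod.fst_zero, Prod.snd_zero, one_mul, zero_mul, mul_zero, add_zero, zero_add]
    at hx hy hi1 hi2
  rcases heightOne_or_exists_isLatticeCorner hS hSc hi (u := (-1, 0)) (w := (0, 1)) (by norm_num)
    with hr | ⟨A, B, p, k, a, hcp, hk, ha, hk'⟩
  · exact columnBound_of_heightOne_neg hS hSc hnc (u := (1, 0)) (w := (0, 1)) (by norm_num) hleft
      (by simpa using hr)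
  rcases heightOne_or_exists_isLatticeCorner hS hSc hi (u := (0, -1)) (w := (-1, 0)) (by norm_num)
    with ht | ⟨E, F, q, b, l, hcq, hb, hl, hl'⟩
  · exact columnBound_of_heightOne_neg hS hSc hnc (u := (0, 1)) (w := (-1, 0)) (by norm_num) hbot
      (by simpa using ht)
  obtain ⟨rfl, rfl⟩ := hcp.eq_of_left hk ha hk' hn hm hbot hnm
  obtain ⟨rfl, rfl⟩ := hcq.eq_of_bottom hb hl hl' hn hm hleft hnm
  have hp2 := hcp.le_left 0 hc.mem
  have hpB := hcp.le_right
  have hq1 := hcq.le_right 0 hc.mem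
  have hqE := hcq.le_left
  simp only [dot, Prod.fst_zero,
    Prod.snd_zero, mul_zero, zero_mul, one_mul, add_zero, zero_add] at hp2 hpB hq1 hqE
  have hp2' : p.2 = 0 := le_antisymm hp2 (hy p hcp.mem)
  have hq1' : q.1 = 0 := le_antisymm hq1 (hx q hcq.mem)
  have e1 := hpB q hcq.mem
  have e2 := hqE p hcp.mem
  have e3 := hpB i (latInterior_subset hSc hi)
  rw [hp2', hq1'] at e1 e2
  rw [hp2', hi1, hi2] at e3
  have hpos : 0 < p.1 := by linarith
  have hqpos : 0 < q.2 := by nlinarith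
  have hpq : p.1 = q.2 := le_antisymm (by nlinarith) (by nlinarith)
  have hk1' : k = 1 := by nlinarith
  obtain ⟨D, hD⟩ := Int.eq_ofNat_of_zero_le hpos.le
  have hST : S = stdTriangle D := by
    refine eq_stdTriangle hSc hc.mem ?_ ?_ fun s hs => ⟨hx s hs, hy s hs, ?_⟩
    · rw [← hD, ← hp2']; exact hcp.mem
    · rw [← hD, hpq, ← hq1']; exact hcq.mem
    · have := hpB s hs
      rw [hk1', hp2'] at this
      linarith
  rw [hST]
  exact stdTriangle_columnBound (by omega)

theorem columnBound_of_noncollinear (hS : S.Finite) (hSc : LatticeConvex S)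
    (hnc : Noncollinear (latInterior S)) : ColumnBound S := by
  obtain ⟨i, hi, -⟩ := hnc (1, 0) (by simp) 0
  obtain ⟨u, w, hdet, hu⟩ : ∃ u w : ℤ × ℤ, u.1 * w.2 - u.2 * w.1 = 1 ∧ HeightOne S u := by
    rcases heightOne_or_exists_isLatticeCorner hS hSc hi (u := (1, 0)) (w := (0, -1))
      (by norm_num) with h | ⟨A, B, p, -, -, hc, -⟩
    · exact ⟨(1, 0), (0, 1), by norm_num, h⟩
    · obtain ⟨j, hj, hj', -⟩ := hc.exists_interior
      exact ⟨A, B, hc.det, p, hc.mem, hc.le_left, j, hj, hj'⟩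
  rcases heightOne_or_exists_isLatticeCorner hS hSc hi (u := -u) (w := w)
    (by simp only [Prod.fst_neg, Prod.snd_neg]; linear_combination hdet)
    with h | ⟨A, B, p, n, m, hc, hn, hm, heq⟩
  · exact columnBound_of_heightOne_neg hS hSc hnc hdet hu h
  · have hd := hc.det
    refine ColumnBound.of_image (c := (dot A p, dot B p)) hd
      (columnBound_of_isLatticeCorner (hS.image _) (hSc.image hd) ?_ ?_ hn hm ?_)
    · rw [latInterior_image hd]
      exact hnc.image hd
    · have h0 : coordMap A B (dot A p, dot B p) p = 0 := by simp [coordMap, Prod.ext_iff]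
      refine ⟨by norm_num, ⟨p, hc.mem, h0⟩, ?_, ?_, ?_⟩
      · rintro _ ⟨s, hs, rfl⟩
        simpa [coordMap, dot] using hc.le_left s hs
      · rintro _ ⟨s, hs, rfl⟩
        simpa [coordMap, dot] using hc.le_right s hs
      · obtain ⟨j, hj, hj1, hj2⟩ := hc.exists_interior
        rw [latInterior_image hd]
        refine ⟨_, ⟨j, hj, rfl⟩, ?_, ?_⟩
        · simp only [coordMap, hj1, hj2]; simp [dot]
        · simp only [coordMap, hj1, hj2]; simp [dot]
    · rw [heightOne_image hd]
      have : u = (-n * A.1 + -m * B.1, -n * A.2 + -m * B.2) := by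
        rw [← neg_neg u, heq]
        refine Prod.ext ?_ ?_ <;> simp only [Prod.fst_neg, Prod.snd_neg] <;> ring
      exact this ▸ hu

end selection

/-- The real linear functional with integer coefficient vector `u`. -/
def realDot (u : ℤ × ℤ) : StrongDual ℝ (ℝ × ℝ) :=
  (u.1 : ℝ) • ContinuousLinearMap.fst ℝ ℝ ℝ + (u.2 : ℝ) • ContinuousLinearMap.snd ℝ ℝ ℝ

theorem realDot_apply (u : ℤ × ℤ) (x : ℝ × ℝ) : realDot u x = u.1 * x.1 + u.2 * x.2 := by
  simp [realDot]

@[simp]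
theorem realDot_toR2 (u p : ℤ × ℤ) : realDot u (toR2 p) = (dot u p : ℝ) := by
  simp [realDot_apply, toR2, dot]

theorem dual_apply_eq (f : StrongDual ℝ (ℝ × ℝ)) (x : ℝ × ℝ) :
    f x = f (1, 0) * x.1 + f (0, 1) * x.2 := by
  have h : x = x.1 • ((1, 0) : ℝ × ℝ) + x.2 • ((0, 1) : ℝ × ℝ) := by ext <;> simp
  conv_lhs => rw [h]
  rw [map_add, map_smul, map_smul, smul_eq_mul, smul_eq_mul]
  ring

theorem toR2_injective : Function.Injective toR2 := fun p q h => by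
  simpa [toR2, Prod.ext_iff] using h

/-- A strict separation of a lattice point from a finite set of lattice points can be achieved
by an integer functional. -/
theorem exists_dot_lt_of_dual_lt {S : Set (ℤ × ℤ)} (hS : S.Finite) {p : ℤ × ℤ}
    (f : StrongDual ℝ (ℝ × ℝ)) (hf : ∀ s ∈ S, f (toR2 s) < f (toR2 p)) :
    ∃ u : ℤ × ℤ, ∀ s ∈ S, dot u s < dot u p := by
  have hopen : IsOpen {x : ℝ × ℝ | ∀ s ∈ S,
      x.1 * (s.1 : ℝ) + x.2 * (s.2 : ℝ) < x.1 * (p.1 : ℝ) + x.2 * (p.2 : ℝ)} := by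
    have : {x : ℝ × ℝ | ∀ s ∈ S,
        x.1 * (s.1 : ℝ) + x.2 * (s.2 : ℝ) < x.1 * (p.1 : ℝ) + x.2 * (p.2 : ℝ)} = ⋂ s ∈ S,
        {x : ℝ × ℝ | x.1 * (s.1 : ℝ) + x.2 * (s.2 : ℝ) < x.1 * (p.1 : ℝ) + x.2 * (p.2 : ℝ)} := by
      ext x; simp
    rw [this]
    exact hS.isOpen_biInter fun s _ => isOpen_lt (by fun_prop) (by fun_prop)
  have hd : DenseRange (Prod.map ((↑) : ℚ → ℝ) ((↑) : ℚ → ℝ)) :=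
    Rat.denseRange_cast.prodMap Rat.denseRange_cast
  obtain ⟨⟨q, r⟩, hqr⟩ := hd.exists_mem_open hopen ⟨(f (1, 0), f (0, 1)), fun s hs => by
    have := hf s hs
    rwa [dual_apply_eq f (toR2 s), dual_apply_eq f (toR2 p)] at this⟩
  refine ⟨(q.num * r.den, r.num * q.den), fun s hs => ?_⟩
  have h := hqr s hs
  simp only [Prod.map_apply] at h
  have h' : q * s.1 + r * s.2 < q * p.1 + r * p.2 := by exact_mod_cast h
  have hq : (q.num : ℚ) = q * q.den := (Rat.mul_den_eq_num q).symm
  have hr : (r.num : ℚ) = r * r.den := (Rat.mul_den_eq_num r).symm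
  have hq0 : (0 : ℚ) < q.den := by exact_mod_cast q.den_pos
  have hr0 : (0 : ℚ) < r.den := by exact_mod_cast r.den_pos
  have key := mul_lt_mul_of_pos_left h' (mul_pos hq0 hr0)
  have : ((dot (q.num * r.den, r.num * q.den) s : ℤ) : ℚ) <
      (dot (q.num * r.den, r.num * q.den) p : ℤ) := by
    simp only [dot]
    push_cast
    rw [hq, hr]
    linarith
  exact_mod_cast this

/-- A weak separation by a nonzero real functional can be achieved by a nonzero integer one. -/
theorem exists_dot_le_of_dual_le {S : Set (ℤ × ℤ)} (hS : S.Finite) {p : ℤ × ℤ}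
    {f : StrongDual ℝ (ℝ × ℝ)} (hf0 : f ≠ 0) (hf : ∀ s ∈ S, f (toR2 s) ≤ f (toR2 p)) :
    ∃ u : ℤ × ℤ, u ≠ 0 ∧ ∀ s ∈ S, dot u s ≤ dot u p := by
  by_cases heq : ∃ s ∈ S, s ≠ p ∧ f (toR2 s) = f (toR2 p)
  · obtain ⟨t, -, htp, ht⟩ := heq
    obtain ⟨α, β, hfe⟩ : ∃ α β : ℝ, ∀ x, f x = α * x.1 + β * x.2 := ⟨_, _, dual_apply_eq f⟩
    have hab : ¬ (α = 0 ∧ β = 0) := fun h => hf0 (by ext <;> simp [hfe, h.1, h.2])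
    simp only [hfe, toR2] at ht hf
    obtain ⟨d, hd⟩ : ∃ d : ℤ × ℤ, d = t - p := ⟨_, rfl⟩
    have hd0 : d ≠ 0 := by rw [hd]; exact sub_ne_zero.2 htp
    have h1 : (d.1 : ℝ) = t.1 - p.1 := by simp [hd]
    have h2 : (d.2 : ℝ) = t.2 - p.2 := by simp [hd]
    have hperp : α * d.1 + β * d.2 = 0 := by rw [h1, h2]; linarith
    obtain ⟨k, hk⟩ : ∃ k : ℝ, k = α * -(d.2 : ℝ) + β * d.1 := ⟨_, rfl⟩
    have hN : (0 : ℝ) < d.1 ^ 2 + d.2 ^ 2 := by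
      have : (d.1 : ℝ) ≠ 0 ∨ (d.2 : ℝ) ≠ 0 := by
        by_contra! h
        exact hd0 (Prod.ext (by exact_mod_cast h.1) (by exact_mod_cast h.2))
      rcases this with h | h <;> positivity
    have hα : α * ((d.1 : ℝ) ^ 2 + d.2 ^ 2) = k * -d.2 := by
      rw [hk]; linear_combination (d.1 : ℝ) * hperp
    have hβ : β * ((d.1 : ℝ) ^ 2 + d.2 ^ 2) = k * d.1 := by
      rw [hk]; linear_combination (d.2 : ℝ) * hperp
    have hk0 : k ≠ 0 := by
      rintro rfl
      rw [zero_mul] at hα hβ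
      exact hab ⟨(mul_eq_zero.1 hα).resolve_right hN.ne', (mul_eq_zero.1 hβ).resolve_right hN.ne'⟩
    have hs : ∀ s ∈ S, k * ((-d.2 : ℝ) * (s.1 - p.1) + d.1 * (s.2 - p.2)) ≤ 0 := fun s hs => by
      have : k * ((-d.2 : ℝ) * (s.1 - p.1) + d.1 * (s.2 - p.2)) =
          ((d.1 : ℝ) ^ 2 + d.2 ^ 2) * (α * (s.1 - p.1) + β * (s.2 - p.2)) := by
        linear_combination -(s.1 - p.1 : ℝ) * hα - (s.2 - p.2 : ℝ) * hβ
      rw [this]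
      exact mul_nonpos_of_nonneg_of_nonpos hN.le (by have := hf s hs; linarith)
    rcases hk0.lt_or_gt with hk0 | hk0
    · refine ⟨(d.2, -d.1), fun h => hd0 ?_, fun s hsS => ?_⟩
      · simp only [Prod.ext_iff, Prod.fst_zero, Prod.snd_zero, neg_eq_zero] at h ⊢
        exact h.symm
      · have := nonneg_of_mul_nonpos_right (hs s hsS) hk0
        have h' : (0 : ℤ) ≤ -d.2 * (s.1 - p.1) + d.1 * (s.2 - p.2) := by exact_mod_cast this
        simp only [dot]
        linarith
    · refine ⟨(-d.2, d.1), fun h => hd0 ?_, fun s hsS => ?_⟩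
      · simp only [Prod.ext_iff, Prod.fst_zero, Prod.snd_zero, neg_eq_zero] at h ⊢
        exact h.symm
      · have := nonpos_of_mul_nonpos_right (hs s hsS) hk0
        have h' : -d.2 * (s.1 - p.1) + d.1 * (s.2 - p.2) ≤ (0 : ℤ) := by exact_mod_cast this
        simp only [dot]
        linarith
  · push Not at heq
    obtain ⟨u, hu⟩ := exists_dot_lt_of_dual_lt (S := S \ {p}) hS.sdiff f
      (fun s hs => lt_of_le_of_ne (hf s hs.1) (heq s hs.1 hs.2))
    by_cases hu0 : u = 0
    · refine ⟨(1, 0), by simp, fun s hs => ?_⟩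
      by_cases hsp : s = p
      · rw [hsp]
      · have := hu s ⟨hs, hsp⟩
        simp [hu0, dot] at this
    · refine ⟨u, hu0, fun s hs => ?_⟩
      by_cases hsp : s = p
      · rw [hsp]
      · exact (hu s ⟨hs, hsp⟩).le

theorem dual_le_of_mem_convexHull {A : Set (ℝ × ℝ)} (f : StrongDual ℝ (ℝ × ℝ)) {c : ℝ}
    (h : ∀ a ∈ A, f a ≤ c) {x : ℝ × ℝ} (hx : x ∈ convexHull ℝ A) : f x ≤ c :=
  convexHull_min (t := {y | f y ≤ c}) h (convex_halfSpace_le f.toLinearMap.isLinear c) hx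

/-- A point outside the interior of the convex hull of a nonempty set is weakly separated from
that set. -/
theorem exists_dual_le_of_notMem_interior {A : Set (ℝ × ℝ)} (hA : A.Nonempty) {x : ℝ × ℝ}
    (hx : x ∉ interior (convexHull ℝ A)) :
    ∃ f : StrongDual ℝ (ℝ × ℝ), f ≠ 0 ∧ ∀ a ∈ A, f a ≤ f x := by
  by_cases hint : (interior (convexHull ℝ A)).Nonempty
  · obtain ⟨f, hf0, hf⟩ :=
      geometric_hahn_banach_of_nonempty_interior_point (convex_convexHull ℝ A) hx hint
    exact ⟨f, hf0, fun a ha => hf a (subset_convexHull ℝ A ha)⟩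
  · rw [interior_convexHull_nonempty_iff_affineSpan_eq_top,
      AffineSubspace.affineSpan_eq_top_iff_vectorSpan_eq_top_of_nonempty ℝ _ _ hA] at hint
    obtain ⟨f, hf0, hf⟩ := Submodule.exists_le_ker_of_lt_top _ (lt_top_iff_ne_top.2 hint)
    obtain ⟨a, ha⟩ := hA
    have hconst : ∀ b ∈ A, f b = f a := fun b hb => by
      have := hf (vsub_mem_vectorSpan ℝ hb ha)
      rw [LinearMap.mem_ker, vsub_eq_sub, map_sub] at this
      linarith
    have hne : LinearMap.toContinuousLinearMap f ≠ 0 := by simpa using hf0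
    rcases le_total (f a) (f x) with h | h
    · exact ⟨LinearMap.toContinuousLinearMap f, hne, fun b hb => by simpa [hconst b hb] using h⟩
    · exact ⟨-LinearMap.toContinuousLinearMap f, neg_ne_zero.2 hne,
        fun b hb => by simpa [hconst b hb] using h⟩

theorem intPts_convexHull {S : Set (ℤ × ℤ)} (hS : S.Finite) :
    intPts (convexHull ℝ (toR2 '' S)) = latInterior S := by
  ext p
  refine ⟨fun hp u hu => ?_, fun hp => ?_⟩
  · by_contra! hcon
    have hle : ∀ x ∈ convexHull ℝ (toR2 '' S), realDot u x ≤ dot u p := fun x hx =>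
      dual_le_of_mem_convexHull _ (by rintro _ ⟨s, hs, rfl⟩; simpa using hcon s hs) hx
    have hcont : Filter.Tendsto (fun ε : ℝ => toR2 p + ε • toR2 u) (nhds 0) (nhds (toR2 p)) := by
      have : Continuous fun ε : ℝ => toR2 p + ε • toR2 u := by fun_prop
      simpa using this.tendsto 0
    have hev := hcont.eventually (mem_interior_iff_mem_nhds.1 hp)
    obtain ⟨ε, hε, hε0⟩ := ((hev.filter_mono nhdsWithin_le_nhds).and
      (self_mem_nhdsWithin (s := Set.Ioi (0 : ℝ)))).exists
    have h := hle _ hε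
    rw [map_add, map_smul, realDot_toR2, realDot_toR2, smul_eq_mul] at h
    have hpos : 0 < dot u u := by
      have : u.1 ≠ 0 ∨ u.2 ≠ 0 := by
        by_contra! h
        exact hu (Prod.ext h.1 h.2)
      simp only [dot, ← sq]
      rcases this with h | h <;> positivity
    have hpos' : (0 : ℝ) < dot u u := by exact_mod_cast hpos
    have := mul_pos (Set.mem_Ioi.1 hε0) hpos'
    linarith
  · by_contra hcon
    obtain ⟨s, hs, -⟩ := hp (1, 0) (by simp)
    obtain ⟨f, hf0, hf⟩ := exists_dual_le_of_notMem_interior ⟨_, Set.mem_image_of_mem toR2 hs⟩ hcon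
    obtain ⟨u, hu0, hu⟩ := exists_dot_le_of_dual_le hS hf0
      (fun s hs => hf _ (Set.mem_image_of_mem _ hs))
    obtain ⟨s, hs, h⟩ := hp u hu0
    exact (hu s hs).not_gt h

theorem latticeConvex_latticePts {Δ : Set (ℝ × ℝ)} (hconv : Convex ℝ Δ) (hclosed : IsClosed Δ)
    (hfin : (latticePts Δ).Finite) : LatticeConvex (latticePts Δ) := by
  intro p hp
  by_contra hcon
  obtain ⟨f, c, hf, hc⟩ := geometric_hahn_banach_closed_point hconv hclosed hcon
  obtain ⟨u, hu⟩ := exists_dot_lt_of_dual_lt hfin f (fun s hs => (hf _ hs).trans hc)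
  obtain ⟨s, hs, h⟩ := hp u
  exact (hu s hs).not_ge h

theorem finite_latticePts {Δ : Set (ℝ × ℝ)} (hΔ : Bornology.IsBounded Δ) :
    (latticePts Δ).Finite := by
  obtain ⟨R, hR⟩ := hΔ.exists_norm_le
  refine (Set.finite_Icc ((-⌈R⌉, -⌈R⌉) : ℤ × ℤ) (⌈R⌉, ⌈R⌉)).subset fun p hp => ?_
  have h := hR _ hp
  rw [toR2, Prod.norm_def, max_le_iff, Real.norm_eq_abs, Real.norm_eq_abs, abs_le, abs_le] at h
  have hc := Int.le_ceil R
  obtain ⟨⟨h1, h2⟩, h3, h4⟩ := h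
  have e1 : ((-⌈R⌉ : ℤ) : ℝ) ≤ (p.1 : ℝ) := by push_cast; linarith
  have e2 : (p.1 : ℝ) ≤ (⌈R⌉ : ℤ) := by linarith
  have e3 : ((-⌈R⌉ : ℤ) : ℝ) ≤ (p.2 : ℝ) := by push_cast; linarith
  have e4 : (p.2 : ℝ) ≤ (⌈R⌉ : ℤ) := by linarith
  exact ⟨⟨Int.cast_le.1 e1, Int.cast_le.1 e3⟩, Int.cast_le.1 e2, Int.cast_le.1 e4⟩

section polytope

variable {Δ : Set (ℝ × ℝ)}

theorem IsLatticePolytope.isCompact (hΔ : IsLatticePolytope Δ) : IsCompact Δ := by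
  obtain ⟨S, rfl⟩ := hΔ
  exact (S.finite_toSet.image toR2).isCompact_convexHull ℝ

theorem IsLatticePolytope.convex (hΔ : IsLatticePolytope Δ) : Convex ℝ Δ := by
  obtain ⟨S, rfl⟩ := hΔ
  exact convex_convexHull ℝ _

theorem IsLatticePolytope.finite_latticePts (hΔ : IsLatticePolytope Δ) : (latticePts Δ).Finite :=
  _root_.finite_latticePts hΔ.isCompact.isBounded

theorem IsLatticePolytope.latticeConvex_latticePts (hΔ : IsLatticePolytope Δ) :
    LatticeConvex (latticePts Δ) :=
  _root_.latticeConvex_latticePts hΔ.convex hΔ.isCompact.isClosed hΔ.finite_latticePts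

theorem IsLatticePolytope.convexHull_latticePts (hΔ : IsLatticePolytope Δ) :
    convexHull ℝ (toR2 '' latticePts Δ) = Δ := by
  refine (convexHull_min ?_ hΔ.convex).antisymm ?_
  · rintro _ ⟨p, hp, rfl⟩
    exact hp
  · obtain ⟨S, hS⟩ := hΔ
    conv_lhs => rw [hS]
    refine convexHull_mono (Set.image_mono fun p hp => ?_)
    rw [latticePts, Set.mem_ofPred_eq, hS]
    exact subset_convexHull ℝ _ (Set.mem_image_of_mem _ hp)

/-- A nonempty level set of a nonzero integer functional is a line. -/
theorem collinear_of_realDot_eq {u : ℤ × ℤ} (hu : u ≠ 0) {c : ℝ} {A : Set (ℝ × ℝ)}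
    (h : ∀ x ∈ A, realDot u x = c) : Collinear ℝ A := by
  rcases A.eq_empty_or_nonempty with rfl | ⟨y, hy⟩
  · exact collinear_empty ℝ _
  have hN : (u.1 : ℝ) ^ 2 + (u.2 : ℝ) ^ 2 ≠ 0 := by
    have : (u.1 : ℝ) ≠ 0 ∨ (u.2 : ℝ) ≠ 0 := by
      by_contra! h
      exact hu (Prod.ext (by exact_mod_cast h.1) (by exact_mod_cast h.2))
    rcases this with h | h <;> positivity
  refine (collinear_iff_of_mem hy).2 ⟨(-(u.2 : ℝ), (u.1 : ℝ)), fun x hx => ?_⟩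
  have e : (u.1 : ℝ) * (x.1 - y.1) + u.2 * (x.2 - y.2) = 0 := by
    have := h x hx
    have := h y hy
    rw [realDot_apply] at *
    linarith
  refine ⟨(u.1 * (x.2 - y.2) - u.2 * (x.1 - y.1)) / ((u.1 : ℝ) ^ 2 + (u.2 : ℝ) ^ 2), ?_⟩
  ext
  · simp only [Prod.smul_mk, vadd_eq_add, Prod.fst_add, smul_eq_mul]
    field_simp
    linear_combination (u.1 : ℝ) * e
  · simp only [Prod.smul_mk, vadd_eq_add, Prod.snd_add, smul_eq_mul]
    field_simp
    linear_combination (u.2 : ℝ) * e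

theorem noncollinear_intPts (h : ¬ IsHyperelliptic Δ) : Noncollinear (intPts Δ) := by
  intro u hu c
  by_contra! hcon
  refine h (collinear_of_realDot_eq hu (c := c) ?_)
  rintro _ ⟨p, hp, rfl⟩
  simp [hcon p hp]

theorem IsLatticeColumn.isColumnVector (hΔ : IsLatticePolytope Δ) {v : ℤ × ℤ}
    (hv : IsLatticeColumn (latticePts Δ) v) : IsColumnVector Δ v := by
  obtain ⟨hv0, u, c, hu, hle, ⟨s, hs, t, ht, hst, hsc, htc⟩, hcol⟩ := hv
  have hmax : ∀ x ∈ Δ, realDot u x ≤ c := fun x hx => by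
    rw [← hΔ.convexHull_latticePts] at hx
    refine dual_le_of_mem_convexHull _ ?_ hx
    rintro _ ⟨p, hp, rfl⟩
    simpa using hle p hp
  have hs' : realDot u (toR2 s) = c := by simp [hsc]
  have ht' : realDot u (toR2 t) = c := by simp [htc]
  refine ⟨hv0, {x ∈ Δ | realDot u x = c}, ⟨fun _ => ⟨realDot u, ?_⟩, ?_, fun hsub => ?_⟩, ?_⟩
  · ext x
    refine ⟨fun hx => ⟨hx.1, fun y hy => (hmax y hy).trans hx.2.ge⟩, fun hx => ⟨hx.1, ?_⟩⟩
    exact (hmax x hx.1).antisymm (hs' ▸ hx.2 _ hs)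
  · exact collinear_of_realDot_eq hu fun x hx => hx.2
  · exact hst (toR2_injective (hsub ⟨hs, hs'⟩ ⟨ht, ht'⟩))
  · rintro p ⟨hp, hpτ⟩
    refine hcol p hp (lt_of_le_of_ne (hle p hp) fun h => hpτ ⟨hp, by simp [h]⟩)

theorem finite_isColumnVector (hΔ : IsLatticePolytope Δ) (hdim : ¬ Collinear ℝ Δ) :
    {v : ℤ × ℤ | IsColumnVector Δ v}.Finite := by
  have hL := hΔ.finite_latticePts
  refine (hL.image2 (fun p q => p - q) hL).subset ?_
  rintro v ⟨-, τ, ⟨-, hcol, -⟩, hτ⟩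
  obtain ⟨p, hp, hpτ⟩ : ∃ p ∈ latticePts Δ, toR2 p ∉ τ := by
    by_contra! hcon
    refine hdim ?_
    rw [← hΔ.convexHull_latticePts]
    rw [collinear_iff_rank_le_one, ← direction_affineSpan, affineSpan_convexHull,
      direction_affineSpan, ← collinear_iff_rank_le_one]
    exact hcol.subset (Set.image_subset_iff.2 hcon)
  exact ⟨p + v, hτ p ⟨hp, hpτ⟩, p, hp, by simp⟩

end polytope

/-- for a 2-dimensional maximal nonhyperelliptic lattice polytope
`Δ ⊂ ℝ²` with `g` interior lattice points and `g⁽¹⁾` interior lattice points of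
`Δ⁽¹⁾`, one has `#(Δ ∩ ℤ²) − c(Δ) − 3 ≤ 2g + 3 − g⁽¹⁾`. -/
theorem lattice_points_minus_columns_le (Δ : Set (ℝ × ℝ))
    (hlat : IsLatticePolytope Δ) (hdim : ¬ Collinear ℝ Δ)
    (hmax : IsMaximalPolytope Δ) (hnh : ¬ IsHyperelliptic Δ) :
    ((latticePts Δ).ncard : ℤ) - (colCount Δ : ℤ) - 3 ≤
      2 * ((intPts Δ).ncard : ℤ) + 3 - ((intPts (interiorHull Δ)).ncard : ℤ) := by
  have hfin := hlat.finite_latticePts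
  have hint : intPts Δ = latInterior (latticePts Δ) := by
    rw [← intPts_convexHull hfin, hlat.convexHull_latticePts]
  have hint_fin : (intPts Δ).Finite := hfin.subset fun p hp =>
    interior_subset (s := Δ) hp
  have hint_hull : intPts (interiorHull Δ) = latInterior (intPts Δ) := intPts_convexHull hint_fin
  obtain ⟨C, hC, hle⟩ := columnBound_of_noncollinear hfin hlat.latticeConvex_latticePts
    (hint ▸ noncollinear_intPts hnh)
  rw [← hint, ← hint_hull] at hle
  have hcard : C.card ≤ colCount Δ := by
    rw [← Set.ncard_coe_finset]
    exact Set.ncard_le_ncard (fun v hv => (hC v hv).isColumnVector hlat)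
      (finite_isColumnVector hlat hdim)
  lia
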